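/- Let n, t, s be integers with 2 ≤ t ≤ n − 2, 0 ≤ s ≤ t − 1, and let k = C(t,2) + t + 2 − s. Then f(n,k) = n + k − t − 2; that is, every connected graph on n vertices with at least n + k − t − 2 edges has tmc at least k, and there exists a connected graph on n vertices with n + k − t − 3 edges whose tmc is less than k. -/

import Mathlib

open SimpleGraph

/-- A walk in a total-colored graph is *total monochromatic* if all of its edges and
internal vertices have the same color. -/
def IsTotalMonoWalk {V : Type*} {G : SimpleGraph V} (ce : Sym2 V → ℕ) (cv : V → ℕ)
    {u v : V} (w : G.Walk u v) : Prop :=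
  ∃ c, (∀ e ∈ w.edges, ce e = c) ∧ ∀ x ∈ w.support.tail.dropLast, cv x = c

/-- A total coloring (edge coloring `ce`, vertex coloring `cv`) of `G` is a
*TMC-coloring* if any two vertices are connected by a total monochromatic path. -/
def IsTMCColoring {V : Type*} (G : SimpleGraph V) (ce : Sym2 V → ℕ) (cv : V → ℕ) : Prop :=
  ∀ u v : V, u ≠ v → ∃ w : G.Walk u v, w.IsPath ∧ IsTotalMonoWalk ce cv w

/-- The number of colors used by a total coloring of `G`:
colors appearing on edges of `G` together with colors appearing on vertices. -/
noncomputable def colorsUsed {V : Type*} (G : SimpleGraph V) (ce : Sym2 V → ℕ) (cv : V → ℕ) : ℕ :=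
  (ce '' G.edgeSet ∪ Set.range cv).ncard

/-- The total monochromatic connection number `tmc G`: the maximum number of colors
used in a TMC-coloring of `G`. -/
noncomputable def tmc {V : Type*} [Fintype V] (G : SimpleGraph V) : ℕ :=
  sSup {k | ∃ ce cv, IsTMCColoring G ce cv ∧ colorsUsed G ce cv = k}

namespace DJS
open scoped Classical
variable {V : Type} (G : SimpleGraph V)

/-- connectedness of a finite vertex set, phrased with cuts -/
def Cn (S : Finset V) : Prop :=
  S.Nonempty ∧ ∀ T ⊆ S, T.Nonempty → T ≠ S → ∃ a ∈ T, ∃ b ∈ S, b ∉ T ∧ G.Adj a b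

/-- outer neighbourhood of `S` inside `U` -/
noncomputable def nb (U S : Finset V) : Finset V :=
  U.filter (fun v => v ∉ S ∧ ∃ s ∈ S, G.Adj s v)

/-- number of neighbours in `U` -/
noncomputable def dg (U : Finset V) (v : V) : ℕ := (U.filter (G.Adj v)).card

/-- twice the number of edges in `U` -/
noncomputable def e2 (U : Finset V) : ℕ := ∑ u ∈ U, dg G U u

def LB (U : Finset V) (l : ℕ) : Prop := ∀ S ⊆ U, Cn G S → (nb G U S).card ≤ l

variable {G}

lemma mem_nb {U S : Finset V} {v : V} : v ∈ nb G U S ↔ v ∈ U ∧ v ∉ S ∧ ∃ s ∈ S, G.Adj s v := by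
  simp [nb]

lemma Cn_singleton (v : V) : Cn G {v} := by
  refine ⟨by simp, ?_⟩
  intro T hT hne hneq
  rcases Finset.subset_singleton_iff.1 hT with h | h
  · simp [h] at hne
  · exact absurd h hneq

lemma Cn_union {S T : Finset V} (hS : Cn G S) (hT : Cn G T) {s t : V} (hs : s ∈ S) (ht : t ∈ T)
    (hst : G.Adj s t) : Cn G (S ∪ T) := by
  refine ⟨hS.1.mono Finset.subset_union_left, ?_⟩
  intro X hX hne hneq
  by_cases h1 : (X ∩ S).Nonempty ∧ X ∩ S ≠ S
  · obtain ⟨a, ha, b, hb, hbn, hab⟩ := hS.2 (X ∩ S) Finset.inter_subset_right h1.1 h1.2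
    simp only [Finset.mem_inter] at ha hbn
    exact ⟨a, ha.1, b, by simp [hb], fun h => hbn ⟨h, hb⟩, hab⟩
  by_cases h2 : (X ∩ T).Nonempty ∧ X ∩ T ≠ T
  · obtain ⟨a, ha, b, hb, hbn, hab⟩ := hT.2 (X ∩ T) Finset.inter_subset_right h2.1 h2.2
    simp only [Finset.mem_inter] at ha hbn
    exact ⟨a, ha.1, b, by simp [hb], fun h => hbn ⟨h, hb⟩, hab⟩
  have k1 : (∀ x ∈ S, x ∉ X) ∨ S ⊆ X := by
    by_cases h : (X ∩ S).Nonempty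
    · right
      have : X ∩ S = S := by by_contra h'; exact h1 ⟨h, h'⟩
      exact Finset.inter_eq_right.1 this
    · left
      intro x hx hx'
      exact h ⟨x, by simp [hx, hx']⟩
  have k2 : (∀ x ∈ T, x ∉ X) ∨ T ⊆ X := by
    by_cases h : (X ∩ T).Nonempty
    · right
      have : X ∩ T = T := by by_contra h'; exact h2 ⟨h, h'⟩
      exact Finset.inter_eq_right.1 this
    · left
      intro x hx hx'
      exact h ⟨x, by simp [hx, hx']⟩
  rcases k1 with k1 | k1 <;> rcases k2 with k2 | k2
  · obtain ⟨x, hx⟩ := hne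
    rcases Finset.mem_union.1 (hX hx) with h | h
    · exact absurd hx (k1 x h)
    · exact absurd hx (k2 x h)
  · exact ⟨t, k2 ht, s, by simp [hs], k1 s hs, hst.symm⟩
  · exact ⟨s, k1 hs, t, by simp [ht], k2 t ht, hst⟩
  · exact absurd (Finset.Subset.antisymm hX (Finset.union_subset k1 k2)) hneq

lemma Cn_insert {S : Finset V} (hS : Cn G S) {s v : V} (hs : s ∈ S) (hst : G.Adj s v) :
    Cn G (insert v S) := by
  have := Cn_union hS (Cn_singleton v) hs (Finset.mem_singleton_self v) hst
  rwa [Finset.union_comm, ← Finset.insert_eq] at this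

lemma dg_union {A B : Finset V} (h : Disjoint A B) (v : V) :
    dg G (A ∪ B) v = dg G A v + dg G B v := by
  unfold dg
  rw [Finset.filter_union, Finset.card_union_of_disjoint]
  exact Finset.disjoint_filter_filter h

lemma dg_mono {A B : Finset V} (h : A ⊆ B) (v : V) : dg G A v ≤ dg G B v :=
  Finset.card_le_card (Finset.filter_subset_filter _ h)

lemma dg_comm (A B : Finset V) : ∑ a ∈ A, dg G B a = ∑ b ∈ B, dg G A b := by
  have := Finset.sum_card_bipartiteAbove_eq_sum_card_bipartiteBelow (s := A) (t := B) (G.Adj)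
  unfold dg
  simp only [Finset.bipartiteAbove, Finset.bipartiteBelow] at this
  rw [this]
  refine Finset.sum_congr rfl fun b _ => ?_
  congr 1
  ext x
  simp [G.adj_comm]

lemma e2_union {A B : Finset V} (h : Disjoint A B) :
    e2 G (A ∪ B) = e2 G A + e2 G B + 2 * ∑ b ∈ B, dg G A b := by
  unfold e2
  rw [Finset.sum_union h]
  simp only [dg_union h, Finset.sum_add_distrib]
  rw [dg_comm A B]
  ring

lemma e2_singleton (v : V) : e2 G {v} = 0 := by
  simp [e2, dg]

lemma e2_insert {A : Finset V} {v : V} (h : v ∉ A) :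
    e2 G (insert v A) = e2 G A + 2 * dg G A v := by
  rw [Finset.insert_eq, Finset.union_comm, e2_union (by simpa using h), e2_singleton]
  simp

lemma e2_even (A : Finset V) : Even (e2 G A) := by
  induction A using Finset.induction_on with
  | empty => simp [e2]
  | insert a s h ih => rw [e2_insert h]; exact ih.add (even_two_mul _)

lemma dg_eq_nb {U : Finset V} {v : V} : dg G U v = (nb G U {v}).card := by
  unfold dg nb
  congr 1
  ext x
  simp only [Finset.mem_filter, Finset.mem_singleton, exists_eq_left]
  constructor
  · rintro ⟨h1, h2⟩; exact ⟨h1, h2.ne', h2⟩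
  · rintro ⟨h1, _, h2⟩; exact ⟨h1, h2⟩

lemma LB.dg_le {U : Finset V} {l : ℕ} (h : LB G U l) {v : V} (hv : v ∈ U) : dg G U v ≤ l := by
  rw [dg_eq_nb]
  exact h _ (by simpa using hv) (Cn_singleton v)

/-- growing step: there is a frontier vertex with an outside neighbour -/
lemma grow_step {U S : Finset V} (hU : Cn G U) (hSU : S ⊆ U) (hne : S.Nonempty)
    (h : S ∪ nb G U S ≠ U) :
    ∃ w ∈ nb G U S, ∃ y ∈ U, y ∉ S ∧ y ∉ nb G U S ∧ G.Adj w y := by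
  have hsub : S ∪ nb G U S ⊆ U := Finset.union_subset hSU (Finset.filter_subset _ _)
  obtain ⟨a, ha, b, hb, hbn, hab⟩ := hU.2 _ hsub (hne.mono Finset.subset_union_left) h
  simp only [Finset.mem_union, not_or] at hbn ha
  rcases ha with ha | ha
  · exact absurd (mem_nb.2 ⟨hb, hbn.1, a, ha, hab⟩) hbn.2
  · exact ⟨a, ha, b, hb, hbn.1, hbn.2, hab⟩

lemma nb_insert_card {U S : Finset V} {w : V} (hw : w ∈ nb G U S) :
    (nb G U (insert w S)).card + 1 =
      (nb G U S).card + dg G (U \ (S ∪ nb G U S)) w := by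
  have : nb G U (insert w S) = (nb G U S).erase w ∪ (U \ (S ∪ nb G U S)).filter (G.Adj w) := by
    ext x
    have hw' := mem_nb.1 hw
    simp only [mem_nb, Finset.mem_union, Finset.mem_erase, Finset.mem_filter, Finset.mem_sdiff,
      Finset.mem_insert]
    constructor
    · rintro ⟨h1, h2, s, hs, h3⟩
      push Not at h2
      by_cases hx : ∃ s ∈ S, G.Adj s x
      · left; exact ⟨h2.1, h1, h2.2, hx⟩
      · right
        rcases hs with rfl | hs
        · exact ⟨⟨h1, by rintro (h | ⟨_, _, h⟩); exacts [h2.2 h, hx h]⟩, h3⟩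
        · exact absurd ⟨s, hs, h3⟩ hx
    · rintro (⟨h1, h2, h3, s, hs, h4⟩ | ⟨⟨h1, h2⟩, h3⟩)
      · exact ⟨h2, by tauto, s, Or.inr hs, h4⟩
      · refine ⟨h1, ?_, w, Or.inl rfl, h3⟩
        rintro (rfl | h)
        · exact G.loopless.irrefl _ h3
        · exact h2 (Or.inl h)
  rw [this, Finset.card_union_of_disjoint, Finset.card_erase_of_mem hw]
  · have : 0 < (nb G U S).card := Finset.card_pos.2 ⟨w, hw⟩
    unfold dg
    omega
  · rw [Finset.disjoint_left]
    intro x hx hx'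
    simp only [Finset.mem_erase, Finset.mem_filter, Finset.mem_sdiff, Finset.mem_union] at hx hx'
    exact hx'.1.2 (Or.inr hx.2)

lemma grow {U : Finset V} (hU : Cn G U) : ∀ (m : ℕ) (S : Finset V), U.card ≤ S.card + m → S ⊆ U →
    Cn G S → ∃ D, S ⊆ D ∧ D ⊆ U ∧ Cn G D ∧ D ∪ nb G U D = U ∧
      (nb G U S).card ≤ (nb G U D).card := by
  intro m
  induction m with
  | zero =>
    intro S hc hSU hS
    have : S = U := Finset.eq_of_subset_of_card_le hSU (by omega)
    refine ⟨S, le_rfl, hSU, hS, ?_, le_rfl⟩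
    subst this
    exact Finset.union_eq_left.2 (Finset.filter_subset _ _)
  | succ m ih =>
    intro S hc hSU hS
    by_cases h : S ∪ nb G U S = U
    · exact ⟨S, le_rfl, hSU, hS, h, le_rfl⟩
    obtain ⟨w, hw, y, hy, hyS, hyn, hwy⟩ := grow_step hU hSU hS.1 h
    have hw' := mem_nb.1 hw
    obtain ⟨hwU, hwS, s, hs, hsw⟩ := hw'
    obtain ⟨D, h1, h2, h3, h4, h5⟩ := ih (insert w S)
      (by rw [Finset.card_insert_of_notMem hwS]; omega)
      (Finset.insert_subset hwU hSU) (Cn_insert hS hs hsw)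
    refine ⟨D, (Finset.subset_insert _ _).trans h1, h2, h3, h4, le_trans ?_ h5⟩
    have := nb_insert_card hw
    have h6 : 0 < dg G (U \ (S ∪ nb G U S)) w :=
      Finset.card_pos.2 ⟨y, by simp [hy, hyS, hyn, hwy]⟩
    omega

/-- rooted paths -/
lemma path_lem : ∀ (m : ℕ) (C : Finset V) (z : V), C.card = m → Cn G C → z ∈ C →
    (∀ T ⊆ C, z ∈ T → Cn G T → (nb G C T).card ≤ 1) → e2 G C + 2 ≤ 2 * C.card := by
  intro m
  induction m with
  | zero => intro C z hc _ hz; simp at hc; simp [hc] at hz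
  | succ m ih =>
    intro C z hc hC hz hT
    have hCe : C = insert z (C.erase z) := (Finset.insert_erase hz).symm
    have hcard : (C.erase z).card + 1 = C.card := Finset.card_erase_add_one hz
    by_cases he : C.erase z = ∅
    · rw [he] at hCe hcard
      rw [hCe]
      simp [e2_singleton]
    have hne : C ≠ {z} := by
      rintro rfl
      simp at he
    obtain ⟨a, ha, z', hz', hz'n, hadj⟩ := hC.2 {z} (by simpa using hz) (by simp) (fun h => hne h.symm)
    simp only [Finset.mem_singleton] at ha hz'n
    subst ha
    have hone := hT {a} (by simpa using hz) (by simp) (Cn_singleton _)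
    have huniq : ∀ y ∈ C, G.Adj a y → y = z' := by
      intro y hy hay
      exact Finset.card_le_one.1 hone y (mem_nb.2 ⟨hy, by simpa using hay.ne', a, by simp, hay⟩)
        z' (mem_nb.2 ⟨hz', by simpa using hz'n, a, by simp, hadj⟩)
    have hC' : Cn G (C.erase a) := by
      refine ⟨Finset.nonempty_iff_ne_empty.2 he, ?_⟩
      intro T hTs hTne hTn
      by_cases hzT : z' ∈ T
      · obtain ⟨p, hp, q, hq, hqn, hpq⟩ := hC.2 (insert a T)
          (Finset.insert_subset hz (hTs.trans (Finset.erase_subset _ _))) (by simp) (by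
            rintro rfl
            apply hTn
            rw [Finset.erase_insert]
            intro h; simpa using hTs h)
        simp only [Finset.mem_insert, not_or] at hp hqn
        rcases hp with rfl | hp
        · have := huniq q hq hpq
          subst this; exact absurd hzT hqn.2
        · exact ⟨p, hp, q, by simp [hq, hqn.1], hqn.2, hpq⟩
      · obtain ⟨p, hp, q, hq, hqn, hpq⟩ := hC.2 T (hTs.trans (Finset.erase_subset _ _)) hTne (by
            rintro rfl
            exact hzT hz')
        refine ⟨p, hp, q, ?_, hqn, hpq⟩
        rw [Finset.mem_erase]
        refine ⟨?_, hq⟩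
        rintro rfl
        have := huniq p (Finset.mem_of_mem_erase (hTs hp)) hpq.symm
        subst this; exact hzT hp
    have hrec := ih (C.erase a) z' (by omega) hC' (by simp [hz', hz'n]) (by
      intro T hTs hzT hTc
      have h1 : Cn G (insert a T) := Cn_insert hTc hzT hadj.symm
      have h2 := hT (insert a T) (Finset.insert_subset hz (hTs.trans (Finset.erase_subset _ _)))
        (by simp) h1
      refine le_trans (Finset.card_le_card ?_) h2
      intro y hy
      rw [mem_nb] at hy ⊢
      obtain ⟨hy1, hy2, s, hs, hsy⟩ := hy
      rw [Finset.mem_erase] at hy1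
      exact ⟨hy1.2, by simp [hy1.1, hy2], s, by simp [hs], hsy⟩)
    have hd : dg G (C.erase a) a ≤ 1 := by
      unfold dg
      rw [Finset.card_le_one]
      intro p hp q hq
      simp only [Finset.mem_filter, Finset.mem_erase] at hp hq
      rw [huniq p hp.1.2 hp.2, huniq q hq.1.2 hq.2]
    rw [hCe, e2_insert (by simp), ← hCe]
    omega

end DJS

namespace DJS
open scoped Classical
variable {V : Type} {G : SimpleGraph V}

def PP (G : SimpleGraph V) (m : ℕ) : Prop := ∀ (U : Finset V) (l : ℕ), 2 ≤ l → U.card < m →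
  Cn G U → LB G U l → l + 3 ≤ U.card → e2 G U + 2 + l ≤ 2 * U.card + l ^ 2

lemma e2_le_mul {C : Finset V} {d : ℕ} (h : ∀ v ∈ C, dg G C v ≤ d) : e2 G C ≤ C.card * d := by
  unfold e2
  simpa using Finset.sum_le_card_nsmul C _ d h

lemma comp_bound {m : ℕ} (hP : PP G m) {C : Finset V} {z : V} {μ : ℕ} (hm : C.card < m)
    (hC : Cn G C) (hz : z ∈ C)
    (hT : ∀ T ⊆ C, z ∈ T → Cn G T → (nb G C T).card ≤ μ + 1) :
    (μ = 0 → e2 G C + 2 ≤ 2 * C.card) ∧ (1 ≤ μ → e2 G C + 1 ≤ 2 * C.card + μ ^ 2 + 4 * μ) := by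
  constructor
  · rintro rfl
    exact path_lem _ C z rfl hC hz (by simpa using hT)
  intro hμ
  have hLB : LB G C (μ + 2) := by
    intro T hTC hTc
    obtain ⟨D, h1, h2, h3, h4, h5⟩ := grow hC C.card T (by omega) hTC hTc
    by_cases hzD : z ∈ D
    · have := hT D h2 hzD h3; omega
    have hzn : z ∈ nb G C D := by
      have : z ∈ D ∪ nb G C D := by rw [h4]; exact hz
      simpa [hzD] using this
    have h6 := nb_insert_card hzn
    obtain ⟨_, _, s, hs, hsz⟩ := mem_nb.1 hzn
    have := hT (insert z D) (Finset.insert_subset hz h2) (by simp) (Cn_insert h3 hs hsz)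
    rw [h4] at h6
    simp [dg] at h6
    omega
  by_cases hc : μ + 5 ≤ C.card
  · have := hP C (μ + 2) (by omega) hm hC hLB (by omega)
    nlinarith
  · have h1 : e2 G C = e2 G (insert z (C.erase z)) := by rw [Finset.insert_erase hz]
    have hs : ∑ v ∈ C, dg G C v = dg G C z + ∑ v ∈ C.erase z, dg G C v :=
      (Finset.add_sum_erase C _ hz).symm
    have h2 : ∑ v ∈ C.erase z, dg G C v ≤ (C.erase z).card * (μ + 2) := by
      simpa using Finset.sum_le_card_nsmul (C.erase z) (dg G C) (μ + 2)
        (fun v hv => hLB.dg_le (Finset.mem_of_mem_erase hv))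
    have h3 : dg G C z ≤ μ + 1 := by
      rw [dg_eq_nb]
      exact hT _ (by simpa using hz) (by simp) (Cn_singleton z)
    have h4 : (C.erase z).card + 1 = C.card := Finset.card_erase_add_one hz
    have h5 : e2 G C = dg G C z + ∑ v ∈ C.erase z, dg G C v := hs
    have h6 : C.card * (μ + 2) = (C.erase z).card * (μ + 2) + (μ + 2) := by rw [← h4]; ring
    have h7 : C.card * μ ≤ (μ + 4) * μ := Nat.mul_le_mul_right _ (by omega)
    nlinarith

lemma QQ {m : ℕ} (hP : PP G m) : ∀ (N : ℕ) (U S : Finset V) (i : ℕ),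
    (U \ (S ∪ nb G U S)).card ≤ N → U.card ≤ m → S ⊆ U → Cn G S →
    (∀ S', S ⊆ S' → S' ⊆ U → Cn G S' → (nb G U S').card ≤ (nb G U S).card + i) →
    (∀ T ⊆ U \ (S ∪ nb G U S), T.Nonempty → ∃ t ∈ T, ∃ y ∈ U, y ∉ T ∧ G.Adj t y) →
    (i = 0 → (U \ (S ∪ nb G U S)).Nonempty →
      e2 G (U \ (S ∪ nb G U S)) + 2 ≤ 2 * (U \ (S ∪ nb G U S)).card) ∧
    (1 ≤ i → e2 G (U \ (S ∪ nb G U S)) + 1 ≤ 2 * (U \ (S ∪ nb G U S)).card + i ^ 2 + 4 * i) := by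
  intro N
  induction N with
  | zero =>
    intro U S i hN hm hSU hS H H1
    have : U \ (S ∪ nb G U S) = ∅ := by simpa using hN
    rw [this]
    refine ⟨fun _ h => by simp at h, fun hi => ?_⟩
    simp [e2]; nlinarith
  | succ N ih =>
    intro U S i hN hm hSU hS H H1
    by_cases hA : (U \ (S ∪ nb G U S)).Nonempty
    swap
    · have : U \ (S ∪ nb G U S) = ∅ := Finset.not_nonempty_iff_eq_empty.1 hA
      rw [this]
      refine ⟨fun _ h => by simp at h, fun hi => ?_⟩
      simp [e2]; nlinarith
    set W := nb G U S with hW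
    set A := U \ (S ∪ W) with hAdef
    obtain ⟨a0, ha0⟩ := hA
    obtain ⟨C, hCm, hCmax⟩ := Finset.exists_max_image (A.powerset.filter (Cn G)) Finset.card
      ⟨{a0}, by simp [ha0, Cn_singleton]⟩
    simp only [Finset.mem_filter, Finset.mem_powerset] at hCm hCmax
    obtain ⟨hCA, hC⟩ := hCm
    have hAU : A ⊆ U := Finset.sdiff_subset
    have hiso : ∀ c ∈ C, ∀ y ∈ A, y ∉ C → ¬ G.Adj c y := by
      intro c hc y hy hyC hcy
      have := hCmax (insert y C) ⟨Finset.insert_subset hy hCA, Cn_insert hC hc hcy⟩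
      rw [Finset.card_insert_of_notMem hyC] at this
      omega
    have hAS : ∀ a ∈ A, a ∉ S ∧ a ∉ W := by
      intro a ha
      simp only [hAdef, Finset.mem_sdiff, Finset.mem_union, not_or] at ha
      exact ha.2
    have hAadj : ∀ a ∈ A, ∀ s ∈ S, ¬ G.Adj s a := by
      intro a ha s hs hsa
      exact (hAS a ha).2 (mem_nb.2 ⟨hAU ha, (hAS a ha).1, s, hs, hsa⟩)
    obtain ⟨z, hz, w, hwU, hwC, hzw⟩ := H1 C hCA hC.1
    have hwA : w ∉ A := fun h => hiso z hz w h hwC hzw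
    have hwS : w ∉ S := fun h => hAadj z (hCA hz) w h hzw.symm
    have hwW : w ∈ W := by
      by_contra h
      exact hwA (by simp [hAdef, hwU, hwS, h])
    obtain ⟨_, _, s0, hs0, hs0w⟩ := mem_nb.1 hwW
    obtain ⟨T0, hT0m, hT0max⟩ := Finset.exists_max_image
      (C.powerset.filter (fun T => z ∈ T ∧ Cn G T)) (fun T => (nb G C T).card)
      ⟨{z}, by simp [hz, Cn_singleton]⟩
    simp only [Finset.mem_filter, Finset.mem_powerset] at hT0m hT0max
    obtain ⟨hT0C, hzT0, hT0⟩ := hT0m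
    set μ := (nb G C T0).card - 1 with hμ
    have hcb := comp_bound hP (z := z) (μ := μ) (C := C) (by
        have h1 : C ⊂ U := by
          refine Finset.ssubset_iff_subset_ne.2 ⟨hCA.trans hAU, ?_⟩
          rintro rfl
          exact hwC hwU
        exact lt_of_lt_of_le (Finset.card_lt_card h1) hm) hC hz (by
        intro T hTC hzT hTc
        have := hT0max T ⟨hTC, hzT, hTc⟩
        omega)
    have hCS : ∀ c ∈ C, c ∉ S ∧ c ∉ W := fun c hc => hAS c (hCA hc)
    have hSUC : S ⊆ U \ C := by
      intro x hx
      rw [Finset.mem_sdiff]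
      exact ⟨hSU hx, fun h => (hCS x h).1 hx⟩
    have hnbeq : nb G (U \ C) S = W := by
      ext x
      rw [hW, mem_nb, mem_nb, Finset.mem_sdiff]
      constructor
      · rintro ⟨⟨h1, h2⟩, h3⟩; exact ⟨h1, h3⟩
      · rintro ⟨h1, h3⟩
        refine ⟨⟨h1, fun h => (hCS x h).2 (mem_nb.2 ⟨h1, h3⟩)⟩, h3⟩
    have hAeq : (U \ C) \ (S ∪ W) = A \ C := by
      ext x; simp only [hAdef, Finset.mem_sdiff, Finset.mem_union]; tauto
    have key : ∀ S', S ⊆ S' → S' ⊆ U \ C → Cn G S' →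
        (nb G (U \ C) S').card + μ ≤ W.card + i := by
      intro S' h1 h2 h3
      have h2U : S' ⊆ U := h2.trans Finset.sdiff_subset
      have hS'C : ∀ x ∈ S', x ∉ C := fun x hx => (Finset.mem_sdiff.1 (h2 hx)).2
      by_cases h0 : μ = 0
      · rw [h0]
        refine le_trans (Finset.card_le_card ?_) (H S' h1 h2U h3)
        intro x hx
        rw [mem_nb] at hx ⊢
        exact ⟨(Finset.mem_sdiff.1 hx.1).1, hx.2⟩
      have hc1 : Cn G (insert w S') := Cn_insert h3 (h1 hs0) hs0w
      have hc2 : Cn G (insert w S' ∪ T0) :=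
        Cn_union hc1 hT0 (Finset.mem_insert_self w S') hzT0 hzw.symm
      have h4 := H _ (h1.trans ((Finset.subset_insert _ _).trans Finset.subset_union_left))
        (Finset.union_subset (Finset.insert_subset hwU h2U) (hT0C.trans (hCA.trans hAU))) hc2
      have hsub : (nb G (U \ C) S').erase w ∪ nb G C T0 ⊆ nb G U (insert w S' ∪ T0) := by
        intro x hx
        simp only [Finset.mem_union, Finset.mem_erase, mem_nb, Finset.mem_sdiff,
          Finset.mem_insert] at hx ⊢
        rcases hx with ⟨hxw, ⟨hxU, hxC⟩, hxS, s, hs, hsx⟩ | ⟨hxC, hxT, s, hs, hsx⟩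
        · refine ⟨hxU, ?_, s, Or.inl (Or.inr hs), hsx⟩
          rintro ((h | h) | h)
          · exact hxw h
          · exact hxS h
          · exact hxC (hT0C h)
        · refine ⟨hAU (hCA hxC), ?_, s, Or.inr hs, hsx⟩
          rintro ((h | h) | h)
          · exact hwC (h ▸ hxC)
          · exact hS'C x h hxC
          · exact hxT h
      have hdis : Disjoint ((nb G (U \ C) S').erase w) (nb G C T0) := by
        rw [Finset.disjoint_left]
        intro x hx hx'
        have := (mem_nb.1 (Finset.mem_of_mem_erase hx)).1
        exact (Finset.mem_sdiff.1 this).2 (mem_nb.1 hx').1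
      have h5 := Finset.card_le_card hsub
      rw [Finset.card_union_of_disjoint hdis] at h5
      have h6 := Finset.pred_card_le_card_erase (a := w) (s := nb G (U \ C) S')
      have h7 := Finset.card_pos.2 hC.1
      omega
    have hμi : μ ≤ i := by
      have := key S le_rfl hSUC hS
      rw [hnbeq] at this
      omega
    have hcardA : (A \ C).card + C.card = A.card := Finset.card_sdiff_add_card_eq_card hCA
    have hCpos := Finset.card_pos.2 hC.1
    have hrec := ih (U \ C) S (i - μ) (by rw [hnbeq, hAeq]; omega)
      ((Finset.card_le_card Finset.sdiff_subset).trans hm) hSUC hS (by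
        intro S' h1 h2 h3
        have := key S' h1 h2 h3
        rw [hnbeq]; omega) (by
        rw [hnbeq, hAeq]
        intro T hT hTne
        obtain ⟨t, ht, y, hy, hyT, hty⟩ := H1 T (hT.trans Finset.sdiff_subset) hTne
        refine ⟨t, ht, y, ?_, hyT, hty⟩
        rw [Finset.mem_sdiff]
        have := Finset.mem_sdiff.1 (hT ht)
        exact ⟨hy, fun h => hiso y h t this.1 this.2 hty.symm⟩)
    rw [hnbeq, hAeq] at hrec
    have he : e2 G A = e2 G (A \ C) + e2 G C := by
      have h1 : A = (A \ C) ∪ C := (Finset.sdiff_union_of_subset hCA).symm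
      conv_lhs => rw [h1]
      rw [e2_union Finset.sdiff_disjoint]
      have : ∑ b ∈ C, dg G (A \ C) b = 0 := by
        apply Finset.sum_eq_zero
        intro b hb
        unfold dg
        rw [Finset.card_eq_zero, Finset.filter_eq_empty_iff]
        intro y hy
        have := Finset.mem_sdiff.1 hy
        exact hiso b hb y this.1 this.2
      omega
    have hsm : i - μ = 0 → e2 G (A \ C) ≤ 2 * (A \ C).card := by
      intro h
      by_cases hne : (A \ C).Nonempty
      · have := hrec.1 h hne; omega
      · rw [Finset.not_nonempty_iff_eq_empty.1 hne]; simp [e2]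
    constructor
    · intro hi _
      have h1 := hcb.1 (by omega)
      have h2 := hsm (by omega)
      omega
    · intro hi
      rcases Nat.eq_zero_or_pos μ with h0 | h0
      · have h1 := hcb.1 h0
        have h2 := hrec.2 (by omega)
        rw [h0] at h2
        simp only [Nat.sub_zero] at h2
        omega
      · have h1 := hcb.2 h0
        rcases Nat.eq_or_lt_of_le hμi with h3 | h3
        · have h2 := hsm (by omega)
          rw [← h3]; omega
        · have h2 := hrec.2 (by omega)
          obtain ⟨d, rfl⟩ := Nat.exists_eq_add_of_le hμi
          simp only [Nat.add_sub_cancel_left] at h2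
          nlinarith [Nat.zero_le (μ * d)]

end DJS

namespace DJS
open scoped Classical
variable {V : Type} {G : SimpleGraph V}

lemma K_grow {H : SimpleGraph V} {W : Finset V} : ∀ (N : ℕ) (B : Finset V), (W \ B).card ≤ N →
    B ⊆ W → (∀ M ⊆ W \ B, M.Nonempty → ∃ m ∈ M, ∃ y ∈ W, y ∉ M ∧ H.Adj m y) →
    e2 H B + 2 * (W \ B).card ≤ e2 H W := by
  intro N
  induction N with
  | zero =>
    intro B hN hB _
    have h1 : W \ B = ∅ := by simpa using hN
    have h2 : W = B := Finset.Subset.antisymm (Finset.sdiff_eq_empty_iff_subset.1 h1) hB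
    subst h2; simp
  | succ N ih =>
    intro B hN hB hM
    by_cases hne : (W \ B).Nonempty
    swap
    · have h1 : W \ B = ∅ := Finset.not_nonempty_iff_eq_empty.1 hne
      have h2 : W = B := Finset.Subset.antisymm (Finset.sdiff_eq_empty_iff_subset.1 h1) hB
      subst h2; simp
    obtain ⟨m, hm, y, hy, hyn, hmy⟩ := hM _ le_rfl hne
    have hmW := (Finset.mem_sdiff.1 hm).1
    have hmB := (Finset.mem_sdiff.1 hm).2
    have hyB : y ∈ B := by
      by_contra h; exact hyn (Finset.mem_sdiff.2 ⟨hy, h⟩)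
    have hsd : W \ insert m B = (W \ B).erase m := by
      ext a; simp only [Finset.mem_sdiff, Finset.mem_insert, Finset.mem_erase]; tauto
    have hc : (W \ insert m B).card + 1 = (W \ B).card := by
      rw [hsd]; exact Finset.card_erase_add_one hm
    have := ih (insert m B) (by omega) (Finset.insert_subset hmW hB) (by
      intro M hMs hMne
      exact hM M (hMs.trans (by rw [hsd]; exact Finset.erase_subset _ _)) hMne)
    rw [e2_insert hmB] at this
    have hd : 0 < dg H B m := Finset.card_pos.2 ⟨y, by simp [hyB, hmy]⟩
    omega

lemma K_lem {H : SimpleGraph V} {W W1 : Finset V} (h1 : W1 ⊆ W)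
    (hno : ∀ M M' : Finset V, M ⊆ W1 → M' ⊆ W1 → M.Nonempty → M'.Nonempty → Disjoint M M' →
      (∀ m ∈ M, ∀ y ∈ W, H.Adj m y → y ∈ M) → (∀ m ∈ M', ∀ y ∈ W, H.Adj m y → y ∈ M') → False) :
    2 * W1.card ≤ e2 H W + 2 := by
  by_cases hcl : ∃ M ⊆ W1, M.Nonempty ∧ ∀ m ∈ M, ∀ y ∈ W, H.Adj m y → y ∈ M
  · obtain ⟨Mx, hMx⟩ := hcl
    obtain ⟨M0, hM0, hmin⟩ := Finset.exists_min_image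
      (W1.powerset.filter (fun M => M.Nonempty ∧ ∀ m ∈ M, ∀ y ∈ W, H.Adj m y → y ∈ M)) Finset.card
      ⟨Mx, by simpa using hMx⟩
    simp only [Finset.mem_filter, Finset.mem_powerset] at hM0 hmin
    obtain ⟨hM0s, ⟨w0, hw0⟩, hM0c⟩ := hM0
    have hsd : W \ insert w0 (W \ W1) = W1.erase w0 := by
      ext a
      simp only [Finset.mem_sdiff, Finset.mem_insert, Finset.mem_erase]
      constructor
      · rintro ⟨h, h'⟩; push Not at h'; exact ⟨h'.1, h'.2 h⟩
      · rintro ⟨h, h'⟩; exact ⟨h1 h', by rintro (rfl | h''); exacts [h rfl, h''.2 h']⟩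
    have := K_grow (H := H) (W := W) _ (insert w0 (W \ W1)) le_rfl
      (Finset.insert_subset (h1 (hM0s hw0)) Finset.sdiff_subset) (by
        rw [hsd]
        intro M hM hMne
        by_contra hcon
        push Not at hcon
        have hMc : ∀ m ∈ M, ∀ y ∈ W, H.Adj m y → y ∈ M := by
          intro m hm y hy hmy
          by_contra h
          exact hcon m hm y hy h hmy
        by_cases hd : Disjoint M M0
        · exact hno M M0 (hM.trans (Finset.erase_subset _ _)) hM0s hMne ⟨w0, hw0⟩ hd hMc hM0c
        · have hi : (M ∩ M0).Nonempty := by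
            rwa [Finset.nonempty_iff_ne_empty, ne_eq, ← Finset.disjoint_iff_inter_eq_empty]
          have h2 := hmin (M ∩ M0) ⟨Finset.inter_subset_right.trans hM0s, hi, by
            intro m hm y hy hmy
            rw [Finset.mem_inter] at hm ⊢
            exact ⟨hMc m hm.1 y hy hmy, hM0c m hm.2 y hy hmy⟩⟩
          have h3 : M ∩ M0 ⊂ M0 := by
            refine Finset.ssubset_iff_subset_ne.2 ⟨Finset.inter_subset_right, ?_⟩
            intro h
            rw [← h] at hw0
            have := hM (Finset.mem_inter.1 hw0).1
            simp at this
          have := Finset.card_lt_card h3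
          omega)
    rw [hsd] at this
    have h4 := Finset.card_erase_add_one (hM0s hw0)
    omega
  · push Not at hcl
    have hsd : W \ (W \ W1) = W1 := Finset.sdiff_sdiff_eq_self h1
    have := K_grow (H := H) (W := W) _ (W \ W1) le_rfl Finset.sdiff_subset (by
      rw [hsd]
      intro M hM hMne
      obtain ⟨m, hm, y, hy, h1, h2⟩ := hcl M hM hMne
      exact ⟨m, hm, y, hy, h2, h1⟩)
    rw [hsd] at this
    omega

lemma e2_compl (W : Finset V) : e2 G W + e2 Gᶜ W + W.card = W.card ^ 2 := by
  have h : ∀ v ∈ W, dg G W v + dg Gᶜ W v + 1 = W.card := by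
    intro v hv
    have h1 : W = insert v (W.filter (G.Adj v) ∪ W.filter (Gᶜ.Adj v)) := by
      ext a
      simp only [Finset.mem_insert, Finset.mem_union, Finset.mem_filter, compl_adj]
      constructor
      · intro ha
        by_cases hav : a = v
        · left; exact hav
        · right
          by_cases hva : G.Adj v a
          · left; exact ⟨ha, hva⟩
          · right; exact ⟨ha, fun h => hav h.symm, hva⟩
      · rintro (rfl | ⟨h, _⟩ | ⟨h, _⟩) <;> assumption
    have h2 : v ∉ W.filter (G.Adj v) ∪ W.filter (Gᶜ.Adj v) := by simp
    have h3 : Disjoint (W.filter (G.Adj v)) (W.filter (Gᶜ.Adj v)) := by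
      rw [Finset.disjoint_left]
      intro a ha hb
      simp only [Finset.mem_filter, compl_adj] at ha hb
      exact hb.2.2 ha.2
    conv_rhs => rw [h1]
    rw [Finset.card_insert_of_notMem h2, Finset.card_union_of_disjoint h3]
    unfold dg
    congr!
  have h4 := Finset.sum_congr rfl h
  simp only [Finset.sum_add_distrib, Finset.sum_const, smul_eq_mul, mul_one] at h4
  rw [pow_two, ← h4]
  rfl

lemma H1_of_Cn {U S : Finset V} (hU : Cn G U) (hSU : S ⊆ U) (hS : S.Nonempty) :
    ∀ T ⊆ U \ (S ∪ nb G U S), T.Nonempty → ∃ t ∈ T, ∃ y ∈ U, y ∉ T ∧ G.Adj t y := by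
  intro T hT hne
  refine hU.2 T (hT.trans Finset.sdiff_subset) hne ?_
  rintro rfl
  obtain ⟨s, hs⟩ := hS
  have := hT (hSU hs)
  simp [hs] at this

lemma lem_j0 {U : Finset V} (hP : PP G U.card) (hU : Cn G U) {l : ℕ} (hLB : LB G U l) {x : V}
    (hx : x ∈ U) (hdx : dg G U x = l) (hl : l + 3 ≤ U.card) :
    e2 G U + 2 + l ≤ 2 * U.card + l ^ 2 := by
  have hWl : (nb G U {x}).card = l := by rw [← dg_eq_nb]; exact hdx
  set W := nb G U {x} with hW
  have hxU : ({x} : Finset V) ⊆ U := by simpa using hx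
  have hQ := QQ hP _ U {x} 0 le_rfl le_rfl hxU (Cn_singleton x)
    (fun S' _ h2 h3 => by rw [← hW, hWl]; exact hLB S' h2 h3) (H1_of_Cn hU hxU (by simp))
  have hH1 := H1_of_Cn hU hxU (by simp)
  have hins : ∀ w ∈ W, dg G (U \ ({x} ∪ W)) w ≤ 1 := by
    intro w hw
    have h1 := nb_insert_card hw
    have hw' := mem_nb.1 hw
    have h2 := hLB (insert w {x}) (Finset.insert_subset hw'.1 hxU)
      (Cn_insert (s := x) (Cn_singleton x) (by simp) (by simpa using hw'.2.2))
    rw [← hW] at h1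
    omega
  rw [← hW] at hQ hH1
  set A := U \ ({x} ∪ W) with hA
  have hAm : ∀ a, a ∈ A ↔ a ∈ U ∧ a ≠ x ∧ a ∉ W := by
    intro a; simp [hA]
  have hWm : ∀ a, a ∈ W ↔ a ∈ U ∧ G.Adj x a := by
    intro a; rw [hW, mem_nb]; simp only [Finset.mem_singleton, exists_eq_left]
    exact ⟨fun h => ⟨h.1, h.2.2⟩, fun h => ⟨h.1, h.2.ne', h.2⟩⟩
  have hxW : x ∉ W := by rw [hWm]; simp
  have hcard : A.card + l + 1 = U.card := by
    have h1 := Finset.card_sdiff_add_card_eq_card (s := {x} ∪ W) (t := U)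
      (Finset.union_subset hxU (Finset.filter_subset _ _))
    rw [← Finset.insert_eq, Finset.card_insert_of_notMem hxW, hWl, Finset.insert_eq, ← hA] at h1
    omega
  have hAne : A.Nonempty := Finset.card_pos.1 (by omega)
  have hQ' := hQ.1 rfl hAne
  -- edges count
  have hUeq : U = insert x W ∪ A := by
    ext a
    simp only [Finset.mem_union, Finset.mem_insert, hAm]
    constructor
    · intro ha; by_cases h1 : a = x <;> by_cases h2 : a ∈ W <;> tauto
    · rintro ((rfl | h) | h)
      · exact hx
      · exact ((hWm a).1 h).1
      · exact h.1
  have hdis : Disjoint (insert x W) A := by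
    rw [Finset.disjoint_left]; intro a ha hb
    rw [hAm] at hb
    rcases Finset.mem_insert.1 ha with h | h
    · exact hb.2.1 h
    · exact hb.2.2 h
  have hAx : dg G A x = 0 := by
    unfold dg
    rw [Finset.card_eq_zero, Finset.filter_eq_empty_iff]
    intro a ha hxa
    rw [hAm] at ha
    exact ha.2.2 ((hWm a).2 ⟨ha.1, hxa⟩)
  have hWx : dg G W x = l := by
    unfold dg
    rw [Finset.filter_true_of_mem, hWl]
    intro a ha
    exact ((hWm a).1 ha).2
  set W1 := W.filter (fun w => dg G A w = 1) with hW1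
  have hsum : ∑ w ∈ W, dg G A w = W1.card := by
    rw [hW1, Finset.card_filter]
    refine Finset.sum_congr rfl fun w hw => ?_
    have := hins w hw
    split_ifs <;> omega
  have hE : e2 G U = e2 G W + 2 * l + e2 G A + 2 * W1.card := by
    conv_lhs => rw [hUeq]
    rw [e2_union hdis, dg_comm A (insert x W), Finset.sum_insert hxW, hAx, hsum, e2_insert hxW, hWx]
    ring
  have hcompl := e2_compl (G := G) W
  have hWU : W ⊆ U := Finset.filter_subset _ _
  have tool : ∀ w ∈ W, ∀ w' ∈ W, G.Adj w w' →
      (∀ y ∈ W, y ≠ w → y ≠ w' → G.Adj w y ∨ G.Adj w' y) →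
      ∀ p ∈ A, ∀ q ∈ A, (G.Adj w p ∨ G.Adj w' p) → (G.Adj w q ∨ G.Adj w' q) → p = q := by
    intro w hw w' hw' hww hdom p hp q hq hwp hwq
    by_contra hpq
    have hc : Cn G (insert w' {w}) := Cn_insert (Cn_singleton w) (by simp) hww
    have h1 := hLB _ (Finset.insert_subset (hWU hw') (by simpa using hWU hw)) hc
    have hsub : insert p (insert q (insert x ((W.erase w).erase w'))) ⊆ nb G U (insert w' {w}) := by
      intro y hy
      simp only [Finset.mem_insert, Finset.mem_erase] at hy
      rw [mem_nb]
      simp only [Finset.mem_insert, Finset.mem_singleton, exists_eq_or_imp, exists_eq_left]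
      rcases hy with rfl | rfl | rfl | ⟨h2, h3, h4⟩
      · have := (hAm y).1 hp
        refine ⟨this.1, ?_, hwp.symm⟩
        rintro (rfl | rfl)
        · exact this.2.2 hw'
        · exact this.2.2 hw
      · have := (hAm y).1 hq
        refine ⟨this.1, ?_, hwq.symm⟩
        rintro (rfl | rfl)
        · exact this.2.2 hw'
        · exact this.2.2 hw
      · refine ⟨hx, ?_, Or.inr ((hWm w).1 hw).2.symm⟩
        rintro (rfl | rfl)
        · exact hxW hw'
        · exact hxW hw
      · exact ⟨hWU h4, by tauto, (hdom y h4 h3 h2).symm⟩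
    have h2 := Finset.card_le_card hsub
    have hp' := (hAm p).1 hp
    have hq' := (hAm q).1 hq
    rw [Finset.card_insert_of_notMem (by
        simp only [Finset.mem_insert, Finset.mem_erase]
        rintro (h | h | h)
        · exact hpq h
        · exact hp'.2.1 h
        · exact hp'.2.2 h.2.2),
      Finset.card_insert_of_notMem (by
        simp only [Finset.mem_insert, Finset.mem_erase]
        rintro (h | h)
        · exact hq'.2.1 h
        · exact hq'.2.2 h.2.2),
      Finset.card_insert_of_notMem (by
        simp only [Finset.mem_erase]
        rintro h
        exact hxW h.2.2),
      Finset.card_erase_of_mem (Finset.mem_erase.2 ⟨hww.ne', hw'⟩),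
      Finset.card_erase_of_mem hw, hWl] at h2
    have : 0 < W.card := Finset.card_pos.2 ⟨w, hw⟩
    omega
  have hK : 2 * W1.card ≤ e2 Gᶜ W + 2 := by
    apply K_lem (Finset.filter_subset _ _)
    intro M M' hM hM' hMne hMne' hMM hcM hcM'
    have hMW : ∀ m ∈ M, m ∈ W := fun m hm => (Finset.mem_filter.1 (hM hm)).1
    have hMW' : ∀ m ∈ M', m ∈ W := fun m hm => (Finset.mem_filter.1 (hM' hm)).1
    have adjM : ∀ m ∈ M, ∀ y ∈ W, y ∉ M → G.Adj m y := by
      intro m hm y hy hyM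
      by_contra h
      exact hyM (hcM m hm y hy (by
        rw [compl_adj]; exact ⟨fun h' => hyM (h' ▸ hm), h⟩))
    have adjM' : ∀ m ∈ M', ∀ y ∈ W, y ∉ M' → G.Adj m y := by
      intro m hm y hy hyM
      by_contra h
      exact hyM (hcM' m hm y hy (by
        rw [compl_adj]; exact ⟨fun h' => hyM (h' ▸ hm), h⟩))
    have hex : ∀ m ∈ W1, ∃ p ∈ A, G.Adj m p := by
      intro m hm
      have h1 : dg G A m = 1 := (Finset.mem_filter.1 hm).2
      obtain ⟨p, hp⟩ := Finset.card_pos.1 (show 0 < (A.filter (G.Adj m)).card by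
        unfold dg at h1; omega)
      exact ⟨p, (Finset.mem_filter.1 hp).1, (Finset.mem_filter.1 hp).2⟩
    obtain ⟨w, hw⟩ := hMne
    obtain ⟨w', hw'⟩ := hMne'
    have hdisj : ∀ a ∈ M, a ∉ M' := fun a h => Finset.disjoint_left.1 hMM h
    obtain ⟨z, hzA, hz⟩ := hex w' (hM' hw')
    have hMz : ∀ m ∈ M, G.Adj m z := by
      intro m hm
      obtain ⟨p, hpA, hp⟩ := hex m (hM hm)
      have : p = z := by
        refine tool m (hMW m hm) w' (hMW' w' hw') (adjM m hm w' (hMW' w' hw')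
          (fun h => hdisj _ h hw')) ?_ p hpA z hzA (Or.inl hp) (Or.inr hz)
        intro y hy _ _
        by_cases hyM : y ∈ M
        · right; exact adjM' w' hw' y hy (hdisj y hyM)
        · left; exact adjM m hm y hy hyM
      rwa [← this]
    have hzz := (hAm z).1 hzA
    by_cases hz2 : ∃ z2 ∈ A, G.Adj z z2
    · obtain ⟨z2, hz2A, hz2⟩ := hz2
      have hzz2 := (hAm z2).1 hz2A
      have hc : Cn G (insert z {w}) := Cn_insert (Cn_singleton w) (by simp) (hMz w hw)
      have h1 := hLB _ (Finset.insert_subset hzz.1 (by simpa using hWU (hMW w hw))) hc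
      have hsub : insert z2 (insert x (W.erase w)) ⊆ nb G U (insert z {w}) := by
        intro y hy
        simp only [Finset.mem_insert, Finset.mem_erase] at hy
        rw [mem_nb]
        simp only [Finset.mem_insert, Finset.mem_singleton, exists_eq_or_imp, exists_eq_left]
        rcases hy with rfl | rfl | ⟨h2, h3⟩
        · refine ⟨hzz2.1, ?_, Or.inl hz2⟩
          rintro (h | rfl)
          · exact hz2.ne' h
          · exact hzz2.2.2 (hMW _ hw)
        · refine ⟨hx, ?_, Or.inr ((hWm w).1 (hMW w hw)).2.symm⟩
          rintro (h | rfl)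
          · exact hzz.2.1 h.symm
          · exact hxW (hMW _ hw)
        · refine ⟨hWU h3, ?_, ?_⟩
          · rintro (rfl | h)
            · exact hzz.2.2 h3
            · exact h2 h
          · by_cases hyM : y ∈ M
            · left; exact (hMz y hyM).symm
            · right; exact adjM w hw y h3 hyM
      have h2 := Finset.card_le_card hsub
      rw [Finset.card_insert_of_notMem (by
          simp only [Finset.mem_insert, Finset.mem_erase]
          rintro (h | h)
          · exact hzz2.2.1 h
          · exact hzz2.2.2 h.2),
        Finset.card_insert_of_notMem (by
          simp only [Finset.mem_erase]
          rintro h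
          exact hxW h.2),
        Finset.card_erase_of_mem (hMW w hw), hWl] at h2
      have : 0 < W.card := Finset.card_pos.2 ⟨w, hMW w hw⟩
      omega
    · push Not at hz2
      have hTne : (A.erase z).Nonempty := by
        apply Finset.card_pos.1
        rw [Finset.card_erase_of_mem hzA]
        omega
      obtain ⟨t, ht, y, hy, hyT, hty⟩ := hH1 (A.erase z) (Finset.erase_subset _ _) hTne
      rw [Finset.mem_erase] at ht
      have hyz : y ≠ z := by
        rintro rfl; exact hz2 t ht.2 hty.symm
      have hyA : y ∉ A := fun h => hyT (Finset.mem_erase.2 ⟨hyz, h⟩)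
      have hyx : y ≠ x := by
        rintro rfl
        have := (hAm t).1 ht.2
        exact this.2.2 ((hWm t).2 ⟨this.1, hty.symm⟩)
      have hyW : y ∈ W := by
        by_contra h; exact hyA ((hAm y).2 ⟨hy, hyx, h⟩)
      have hyM : y ∉ M := by
        intro h
        have h1 := hins y hyW
        have h2 := Finset.card_le_one.1 h1 z (by simp [hzA, hMz y h]) t (by simp [ht.2, hty.symm])
        exact ht.1 h2.symm
      have := tool w (hMW w hw) y hyW (adjM w hw y hyW hyM) (by
        intro a ha _ _
        by_cases haM : a ∈ M
        · right; exact (adjM a haM y hyW hyM).symm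
        · left; exact adjM w hw a ha haM) z hzA t ht.2 (Or.inl (hMz w hw)) (Or.inr hty.symm)
      exact ht.1 this.symm
  rw [hWl] at hcompl
  omega

end DJS

namespace DJS
open scoped Classical
variable {V : Type} {G : SimpleGraph V}

/-- contraction of `b` into `a` -/
def ctr (G : SimpleGraph V) (a b : V) : SimpleGraph V where
  Adj u v := u ≠ v ∧ (G.Adj u v ∨ (u = a ∧ G.Adj b v) ∨ (v = a ∧ G.Adj b u))
  symm := ⟨by
    rintro u v ⟨h, h'⟩
    refine ⟨h.symm, ?_⟩
    rcases h' with h' | h' | h'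
    · exact Or.inl h'.symm
    · exact Or.inr (Or.inr h')
    · exact Or.inr (Or.inl h')⟩
  loopless := ⟨fun u h => h.1 rfl⟩

lemma ctr_adj {a b u v : V} : (ctr G a b).Adj u v ↔
    u ≠ v ∧ (G.Adj u v ∨ (u = a ∧ G.Adj b v) ∨ (v = a ∧ G.Adj b u)) := Iff.rfl

lemma ctr_of {a b u v : V} (h : G.Adj u v) : (ctr G a b).Adj u v := ⟨h.ne, Or.inl h⟩

lemma ctr_e2 {U : Finset V} {a b : V} (ha : a ∈ U) (hb : b ∈ U) (hab : G.Adj a b)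
    (hno : ∀ c ∈ U, G.Adj a c → ¬ G.Adj b c) :
    e2 G U = e2 (ctr G a b) (U.erase b) + 2 := by
  set R := (U.erase b).erase a with hR
  have haU : a ∈ U.erase b := Finset.mem_erase.2 ⟨hab.ne, ha⟩
  have h1 : U.erase b = insert a R := (Finset.insert_erase haU).symm
  have h2 : U = insert b (insert a R) := by rw [← h1, Finset.insert_erase hb]
  have haR : a ∉ R := by simp [hR]
  have hbR : b ∉ insert a R := by simp [hR, hab.ne']
  have hbR' : b ∉ R := by simp [hR]
  have e0 : e2 (ctr G a b) R = e2 G R := by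
    unfold e2 dg
    refine Finset.sum_congr rfl fun u hu => ?_
    congr 1
    ext v
    simp only [Finset.mem_filter, ctr_adj, and_congr_right_iff]
    intro hv
    have hua : u ≠ a := by rintro rfl; exact haR hu
    have hva : v ≠ a := by rintro rfl; exact haR hv
    constructor
    · rintro ⟨_, h | h | h⟩
      · exact h
      · exact absurd h.1 hua
      · exact absurd h.1 hva
    · intro h; exact ⟨h.ne, Or.inl h⟩
  have e1 : dg (ctr G a b) R a = dg G R a + dg G R b := by
    unfold dg
    rw [← Finset.card_union_of_disjoint]
    · congr 1
      ext v
      simp only [Finset.mem_filter, Finset.mem_union, ctr_adj]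
      constructor
      · rintro ⟨hv, hne, h | h | h⟩
        · left; exact ⟨hv, h⟩
        · right; exact ⟨hv, h.2⟩
        · exact absurd h.1.symm hne
      · rintro (h | h)
        · exact ⟨h.1, h.2.ne, Or.inl h.2⟩
        · exact ⟨h.1, by rintro rfl; exact haR h.1, Or.inr (Or.inl ⟨trivial, h.2⟩)⟩
    · rw [Finset.disjoint_left]
      intro v hv hv'
      simp only [Finset.mem_filter] at hv hv'
      exact hno v (by rw [h2]; simp [hv.1]) hv.2 hv'.2
  have e3 : dg G (insert a R) b = dg G R b + 1 := by
    unfold dg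
    rw [Finset.filter_insert, if_pos hab.symm, Finset.card_insert_of_notMem]
    simp [haR]
  rw [h1, e2_insert haR, e0, e1]
  conv_lhs => rw [h2]
  rw [e2_insert hbR, e2_insert haR, e3]
  ring

lemma ctr_Cn {U : Finset V} {a b : V} (ha : a ∈ U) (hb : b ∈ U) (hab : G.Adj a b)
    (hU : Cn G U) : Cn (ctr G a b) (U.erase b) := by
  refine ⟨⟨a, Finset.mem_erase.2 ⟨hab.ne, ha⟩⟩, ?_⟩
  intro T hT hne hneq
  have hbT : b ∉ T := fun h => by simpa using hT h
  by_cases haT : a ∈ T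
  · obtain ⟨p, hp, q, hq, hqn, hpq⟩ := hU.2 (insert b T)
      (Finset.insert_subset hb (hT.trans (Finset.erase_subset _ _))) (by simp) (by
        rintro rfl
        exact hneq (by rw [Finset.erase_insert hbT]))
    simp only [Finset.mem_insert, not_or] at hp hqn
    have hqU : q ∈ U.erase b := Finset.mem_erase.2 ⟨hqn.1, hq⟩
    rcases hp with rfl | hp
    · exact ⟨a, haT, q, hqU, hqn.2, by rintro rfl; exact hqn.2 haT, Or.inr (Or.inl ⟨rfl, hpq⟩)⟩
    · exact ⟨p, hp, q, hqU, hqn.2, ctr_of hpq⟩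
  · obtain ⟨p, hp, q, hq, hqn, hpq⟩ := hU.2 T
      (hT.trans (Finset.erase_subset _ _)) hne (by
        rintro rfl; exact haT ha)
    by_cases hqb : q = b
    · subst hqb
      refine ⟨p, hp, a, Finset.mem_erase.2 ⟨hab.ne, ha⟩, haT, ?_, Or.inr (Or.inr ⟨rfl, hpq.symm⟩)⟩
      rintro rfl; exact haT hp
    · exact ⟨p, hp, q, Finset.mem_erase.2 ⟨hqb, hq⟩, hqn, ctr_of hpq⟩

lemma ctr_LB {U : Finset V} {a b : V} (hb : b ∈ U) (hab : G.Adj a b) {l : ℕ}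
    (hL : LB G U l) : LB (ctr G a b) (U.erase b) l := by
  intro S hS hSc
  have hSU : S ⊆ U := hS.trans (Finset.erase_subset _ _)
  have hbS : b ∉ S := fun h => by simpa using hS h
  by_cases haS : a ∈ S
  · have hc : Cn G (insert b S) := by
      refine ⟨by simp, ?_⟩
      intro T hT hne hneq
      by_cases haT : a ∈ T <;> by_cases hbT : b ∈ T
      · obtain ⟨p, hp, q, hq, hqn, hpq⟩ := hSc.2 (T.erase b) (by
            intro x hx
            have h1 := Finset.mem_erase.1 hx
            have h2 := hT h1.2
            simpa [h1.1] using h2) ⟨a, Finset.mem_erase.2 ⟨hab.ne, haT⟩⟩ (by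
            intro h
            apply hneq
            rw [← h, Finset.insert_erase hbT])
        have hqT : q ∉ T := fun h => hqn (Finset.mem_erase.2 ⟨by rintro rfl; exact hbS hq, h⟩)
        have hpT := (Finset.mem_erase.1 hp).2
        rcases hpq.2 with h | h | h
        · exact ⟨p, hpT, q, by simp [hq], hqT, h⟩
        · exact ⟨b, hbT, q, by simp [hq], hqT, h.2⟩
        · exact absurd (h.1 ▸ haT) hqT
      · exact ⟨a, haT, b, by simp, hbT, hab⟩
      · exact ⟨b, hbT, a, by simp [haS], haT, hab.symm⟩
      · obtain ⟨p, hp, q, hq, hqn, hpq⟩ := hSc.2 T (by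
            intro x hx
            have h2 := hT hx
            rcases Finset.mem_insert.1 h2 with rfl | h
            · exact absurd hx hbT
            · exact h) hne (by rintro rfl; exact haT haS)
        rcases hpq.2 with h | h | h
        · exact ⟨p, hp, q, by simp [hq], hqn, h⟩
        · exact absurd (h.1 ▸ hp) haT
        · exact ⟨p, hp, b, by simp, hbT, h.2.symm⟩
    refine le_trans (Finset.card_le_card ?_) (hL _ (Finset.insert_subset hb hSU) hc)
    intro y hy
    obtain ⟨h1, h2, s, hs, hsy⟩ := mem_nb.1 hy
    rw [Finset.mem_erase] at h1
    rw [mem_nb]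
    refine ⟨h1.2, by simp [h1.1, h2], ?_⟩
    rcases hsy.2 with h | h | h
    · exact ⟨s, by simp [hs], h⟩
    · exact ⟨b, by simp, h.2⟩
    · exact absurd (h.1 ▸ haS) h2
  · have hc : Cn G S := by
      refine ⟨hSc.1, ?_⟩
      intro T hT hne hneq
      obtain ⟨p, hp, q, hq, hqn, hpq⟩ := hSc.2 T hT hne hneq
      refine ⟨p, hp, q, hq, hqn, ?_⟩
      rcases hpq.2 with h | h | h
      · exact h
      · exact absurd (h.1 ▸ hT hp) haS
      · exact absurd (h.1 ▸ hq) haS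
    refine le_trans ?_ (hL _ hSU hc)
    have hgen : ∀ y ∈ nb (ctr G a b) (U.erase b) S, y ∈ nb G U S ∨ (y = a ∧ b ∈ nb G U S) := by
      intro y hy
      obtain ⟨h1, h2, s, hs, hsy⟩ := mem_nb.1 hy
      rw [Finset.mem_erase] at h1
      rcases hsy.2 with h | h | h
      · left; exact mem_nb.2 ⟨h1.2, h2, s, hs, h⟩
      · exact absurd (h.1 ▸ hs) haS
      · right; exact ⟨h.1, mem_nb.2 ⟨hb, hbS, s, hs, h.2.symm⟩⟩
    have hbn : ∀ y ∈ nb (ctr G a b) (U.erase b) S, y ≠ b := by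
      intro y hy
      exact (Finset.mem_erase.1 (mem_nb.1 hy).1).1
    by_cases hbN : b ∈ nb G U S
    · by_cases haN : a ∈ nb G U S
      · apply Finset.card_le_card
        intro y hy
        rcases hgen y hy with h | h
        · exact h
        · rw [h.1]; exact haN
      · have hsub : nb (ctr G a b) (U.erase b) S ⊆ insert a ((nb G U S).erase b) := by
          intro y hy
          rw [Finset.mem_insert, Finset.mem_erase]
          rcases hgen y hy with h | h
          · right; exact ⟨hbn y hy, h⟩
          · left; exact h.1
        refine (Finset.card_le_card hsub).trans ?_
        refine (Finset.card_insert_le _ _).trans ?_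
        rw [Finset.card_erase_add_one hbN]
    · apply Finset.card_le_card
      intro y hy
      rcases hgen y hy with h | h
      · exact h
      · exact absurd h.2 hbN

lemma ctr_case {U : Finset V} (hP : ∀ G' : SimpleGraph V, PP G' U.card) (hU : Cn G U) {l : ℕ}
    (hl2 : 2 ≤ l) (hLB : LB G U l) (hl : l + 4 ≤ U.card) {a b : V}
    (ha : a ∈ U) (hb : b ∈ U) (hab : G.Adj a b)
    (hno : ∀ c ∈ U, G.Adj a c → ¬ G.Adj b c) : e2 G U + 2 + l ≤ 2 * U.card + l ^ 2 := by
  have hc := Finset.card_erase_add_one hb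
  have := hP (ctr G a b) (U.erase b) l hl2 (by omega) (ctr_Cn ha hb hab hU) (ctr_LB hb hab hLB)
    (by omega)
  rw [ctr_e2 ha hb hab hno]
  omega

/-- maximum degree three -/
lemma lem_d3 {U : Finset V} (hP : ∀ G' : SimpleGraph V, PP G' U.card) (hU : Cn G U) {l : ℕ}
    (hl4 : 4 ≤ l) (hLB : LB G U l) (hl : l + 3 ≤ U.card) (hd : ∀ v ∈ U, dg G U v ≤ 3) {x : V}
    (hx : x ∈ U) (hdx : dg G U x = 3) : e2 G U + 2 + l ≤ 2 * U.card + l ^ 2 := by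
  by_cases h4 : l + 4 ≤ U.card
  swap
  · have h1 := e2_le_mul hd
    have h2 : U.card = l + 3 := by omega
    rw [h2] at h1 ⊢
    nlinarith
  by_contra hcon
  have htri : ∀ a ∈ U, ∀ b ∈ U, G.Adj a b → ∃ c ∈ U, G.Adj a c ∧ G.Adj b c := by
    intro a ha b hb hab
    by_contra h
    push Not at h
    exact hcon (ctr_case hP hU (by omega) hLB h4 ha hb hab h)
  have hxU : ({x} : Finset V) ⊆ U := by simpa using hx
  by_cases hall : {x} ∪ nb G U {x} = U
  · have h1 := Finset.card_union_le {x} (nb G U {x})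
    rw [hall, ← dg_eq_nb, hdx] at h1
    simp at h1
    omega
  obtain ⟨w, hw, y, hy, hyx, hyn, hwy⟩ := grow_step hU hxU (by simp) hall
  have hW : ∀ v, v ∈ nb G U {x} ↔ v ∈ U ∧ G.Adj x v := by
    intro a; rw [mem_nb]; simp only [Finset.mem_singleton, exists_eq_left]
    exact ⟨fun h => ⟨h.1, h.2.2⟩, fun h => ⟨h.1, h.2.ne', h.2⟩⟩
  rw [Finset.mem_singleton] at hyx
  rw [hW] at hw hyn
  have hxy : ¬ G.Adj x y := fun h => hyn ⟨hy, h⟩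
  -- common neighbour of x and w, of w and y
  obtain ⟨c, hc, hxc, hwc⟩ := htri x hx w hw.1 hw.2
  obtain ⟨d, hd', hwd, hyd⟩ := htri w hw.1 y hy hwy
  have hxd : d ≠ x := by rintro rfl; exact hxy hyd.symm
  have hcy : c ≠ y := by rintro rfl; exact hxy hxc
  have hdc : d = c := by
    by_contra hne
    have h1 := hd w hw.1
    have h2 : ({x, y, c, d} : Finset V) ⊆ U.filter (G.Adj w) := by
      intro v hv
      simp only [Finset.mem_insert, Finset.mem_singleton] at hv
      rw [Finset.mem_filter]
      rcases hv with rfl | rfl | rfl | rfl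
      · exact ⟨hx, hw.2.symm⟩
      · exact ⟨hy, hwy⟩
      · exact ⟨hc, hwc⟩
      · exact ⟨hd', hwd⟩
    have h3 := Finset.card_le_card h2
    rw [Finset.card_insert_of_notMem (by
        simp only [Finset.mem_insert, Finset.mem_singleton]
        rintro (h | h | h)
        · exact hyx h.symm
        · exact hxc.ne h
        · exact hxd h.symm),
      Finset.card_insert_of_notMem (by
        simp only [Finset.mem_insert, Finset.mem_singleton]
        rintro (h | h)
        · exact hcy h.symm
        · exact hyd.ne h), Finset.card_insert_of_notMem (by
        simp only [Finset.mem_singleton]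
        intro h; exact hne h.symm), Finset.card_singleton] at h3
    unfold dg at h1
    omega
  subst hdc
  -- third neighbour of x
  have h3 : 0 < (((U.filter (G.Adj x)).erase w).erase d).card := by
    have h1 : (U.filter (G.Adj x)).card = 3 := hdx
    have := Finset.pred_card_le_card_erase (a := w) (s := U.filter (G.Adj x))
    have := Finset.pred_card_le_card_erase (a := d) (s := (U.filter (G.Adj x)).erase w)
    omega
  obtain ⟨f, hf⟩ := Finset.card_pos.1 h3
  simp only [Finset.mem_erase, Finset.mem_filter] at hf
  obtain ⟨hfd, hfw, hfU, hxf⟩ := hf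
  obtain ⟨g, hg, hxg, hfg⟩ := htri x hx f hfU hxf
  -- neighbours of x are exactly w, d, f
  have hgw : g = w ∨ g = d := by
    by_contra hne
    push Not at hne
    have h2 : ({w, d, f, g} : Finset V) ⊆ U.filter (G.Adj x) := by
      intro v hv
      simp only [Finset.mem_insert, Finset.mem_singleton] at hv
      rw [Finset.mem_filter]
      rcases hv with rfl | rfl | rfl | rfl
      · exact hw
      · exact ⟨hc, hxc⟩
      · exact ⟨hfU, hxf⟩
      · exact ⟨hg, hxg⟩
    have h3 := Finset.card_le_card h2
    rw [Finset.card_insert_of_notMem (by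
        simp only [Finset.mem_insert, Finset.mem_singleton]
        rintro (h | h | h)
        · exact hwd.ne h
        · exact hfw h.symm
        · exact hne.1 h.symm),
      Finset.card_insert_of_notMem (by
        simp only [Finset.mem_insert, Finset.mem_singleton]
        rintro (h | h)
        · exact hfd h.symm
        · exact hne.2 h.symm), Finset.card_insert_of_notMem (by
        simp only [Finset.mem_singleton]
        intro h; exact hfg.ne h), Finset.card_singleton] at h3
    unfold dg at hdx
    omega
  -- then g has the four neighbours x, y, f and the other one
  have four : ∀ p ∈ U, ∀ q ∈ U, G.Adj p x → G.Adj p y → G.Adj p f → G.Adj p q → G.Adj x q →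
      q ≠ f → False := by
    intro p hp q hq h1 h2 h3 h4 h5 h6
    have hs : ({x, y, f, q} : Finset V) ⊆ U.filter (G.Adj p) := by
      intro v hv
      simp only [Finset.mem_insert, Finset.mem_singleton] at hv
      rw [Finset.mem_filter]
      rcases hv with rfl | rfl | rfl | rfl
      · exact ⟨hx, h1⟩
      · exact ⟨hy, h2⟩
      · exact ⟨hfU, h3⟩
      · exact ⟨hq, h4⟩
    have h7 := Finset.card_le_card hs
    rw [Finset.card_insert_of_notMem (by
        simp only [Finset.mem_insert, Finset.mem_singleton]
        rintro (h | h | h)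
        · exact hyx h.symm
        · exact hxf.ne h
        · exact h5.ne h),
      Finset.card_insert_of_notMem (by
        simp only [Finset.mem_insert, Finset.mem_singleton]
        rintro (h | h)
        · exact hxy (h ▸ hxf)
        · exact hxy (h ▸ h5)), Finset.card_insert_of_notMem (by
        simp only [Finset.mem_singleton]
        intro h; exact h6 h.symm), Finset.card_singleton] at h7
    have := hd p hp
    unfold dg at this
    omega
  rcases hgw with rfl | rfl
  · exact four g hg d hc hxg.symm hwy hfg.symm hwd hxc (fun h => hfd h.symm)
  · exact four g hg w hw.1 hxg.symm hyd.symm hfg.symm hwd.symm hw.2 (fun h => hfw h.symm)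

end DJS

namespace DJS
open scoped Classical
variable {V : Type} {G : SimpleGraph V}

lemma dgS_zero {U S : Finset V} {s : V} (hs : s ∈ S) : dg G (U \ (S ∪ nb G U S)) s = 0 := by
  unfold dg
  rw [Finset.card_eq_zero, Finset.filter_eq_empty_iff]
  intro y hy hsy
  simp only [Finset.mem_sdiff, Finset.mem_union, not_or] at hy
  exact hy.2.2 (mem_nb.2 ⟨hy.1, hy.2.1, s, hs, hsy⟩)

lemma disj_S_nb (U S : Finset V) : Disjoint S (nb G U S) := by
  rw [Finset.disjoint_left]
  intro a ha hb
  exact (mem_nb.1 hb).2.1 ha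

lemma card_split {U S : Finset V} (hS : S ⊆ U) :
    (U \ (S ∪ nb G U S)).card + S.card + (nb G U S).card = U.card := by
  have h1 := Finset.card_sdiff_add_card_eq_card (s := S ∪ nb G U S) (t := U)
      (Finset.union_subset hS (Finset.filter_subset _ _))
  rw [Finset.card_union_of_disjoint (disj_S_nb U S)] at h1
  omega

lemma e2_split {U S : Finset V} (hS : S ⊆ U) {d c : ℕ} (hd : ∀ v ∈ U, dg G U v ≤ d)
    (hc : ∀ w ∈ nb G U S, dg G (U \ (S ∪ nb G U S)) w ≤ c) :
    e2 G U ≤ (S.card + (nb G U S).card) * d + (nb G U S).card * c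
      + e2 G (U \ (S ∪ nb G U S)) := by
  set W := nb G U S with hW
  set A := U \ (S ∪ W) with hA
  have hWU : W ⊆ U := Finset.filter_subset _ _
  have hSW : S ∪ W ⊆ U := Finset.union_subset hS hWU
  have hU : U = (S ∪ W) ∪ A := (Finset.union_sdiff_of_subset hSW).symm
  have hdis : Disjoint (S ∪ W) A := Finset.disjoint_sdiff
  have h1 : e2 G U = ∑ u ∈ S ∪ W, dg G U u + ∑ u ∈ A, dg G U u := by
    rw [← Finset.sum_union hdis, ← hU]; rfl
  have h2 : ∑ u ∈ A, dg G U u = ∑ u ∈ S ∪ W, dg G A u + e2 G A := by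
    rw [dg_comm (S ∪ W) A]
    unfold e2
    rw [← Finset.sum_add_distrib]
    refine Finset.sum_congr rfl fun u _ => ?_
    conv_lhs => rw [hU]
    exact dg_union hdis u
  have h3 : ∑ u ∈ S ∪ W, dg G A u = ∑ u ∈ W, dg G A u := by
    rw [Finset.sum_union (disj_S_nb U S), Finset.sum_eq_zero, zero_add]
    intro s hs
    exact dgS_zero hs
  have h4 : ∑ u ∈ W, dg G A u ≤ W.card * c := by
    simpa using Finset.sum_le_card_nsmul W (dg G A) c hc
  have h5 : ∑ u ∈ S ∪ W, dg G U u ≤ (S ∪ W).card * d := by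
    simpa using Finset.sum_le_card_nsmul (S ∪ W) (dg G U) d (fun v hv => hd v (hSW hv))
  rw [Finset.card_union_of_disjoint (disj_S_nb U S), ← hW] at h5
  omega

lemma lem_big {U : Finset V} (hP : PP G U.card) (hU : Cn G U) {l D : ℕ} (hLB : LB G U l) {x : V}
    (hx : x ∈ U) (hdx : dg G U x = D) (hd : ∀ v ∈ U, dg G U v ≤ D) (hD : 4 ≤ D) (hDl : D < l)
    (hl : l + 3 ≤ U.card) : e2 G U + 2 + l ≤ 2 * U.card + l ^ 2 := by
  have hxU : ({x} : Finset V) ⊆ U := by simpa using hx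
  obtain ⟨S, hSm, hSmax⟩ := Finset.exists_max_image
    (U.powerset.filter (fun S => Cn G S ∧ D + 2 * S.card ≤ (nb G U S).card + 2)) Finset.card
    ⟨{x}, by
      simp only [Finset.mem_filter, Finset.mem_powerset]
      refine ⟨hxU, Cn_singleton x, ?_⟩
      rw [← dg_eq_nb, hdx]; simp⟩
  simp only [Finset.mem_filter, Finset.mem_powerset] at hSm hSmax
  obtain ⟨hSU, hS, hScard⟩ := hSm
  have hSl := hLB S hSU hS
  have hSpos := Finset.card_pos.2 hS.1
  have ha2 : ∀ w ∈ nb G U S, dg G (U \ (S ∪ nb G U S)) w ≤ 2 := by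
    intro w hw
    by_contra h3
    obtain ⟨hwU, hwS, s, hs, hsw⟩ := mem_nb.1 hw
    have h1 := nb_insert_card hw
    have h2 := hSmax (insert w S) ⟨Finset.insert_subset hwU hSU, Cn_insert hS hs hsw, by
      rw [Finset.card_insert_of_notMem hwS]; omega⟩
    rw [Finset.card_insert_of_notMem hwS] at h2
    omega
  have hcard := card_split (G := G) hSU
  obtain ⟨i, hi⟩ := Nat.exists_eq_add_of_le hSl
  obtain ⟨j, hj⟩ := Nat.exists_eq_add_of_le hDl.le
  have hQ := QQ hP _ U S i le_rfl le_rfl hSU hS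
    (fun S' _ h2 h3 => by rw [← hi]; exact hLB S' h2 h3) (H1_of_Cn hU hSU hS.1)
  have hj1 : 1 ≤ j := by omega
  have hev := e2_even (G := G) (U \ (S ∪ nb G U S))
  rcases Nat.eq_zero_or_pos i with hi0 | hi0
  · subst hi0
    have ha1 : ∀ w ∈ nb G U S, dg G (U \ (S ∪ nb G U S)) w ≤ 1 := by
      intro w hw
      obtain ⟨hwU, hwS, s, hs, hsw⟩ := mem_nb.1 hw
      have h1 := nb_insert_card hw
      have := hLB _ (Finset.insert_subset hwU hSU) (Cn_insert hS hs hsw)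
      omega
    have hsp := e2_split hSU hd ha1
    have hA : e2 G (U \ (S ∪ nb G U S)) ≤ 2 * (U \ (S ∪ nb G U S)).card := by
      by_cases hne : (U \ (S ∪ nb G U S)).Nonempty
      · have := hQ.1 rfl hne; omega
      · rw [Finset.not_nonempty_iff_eq_empty.1 hne]; simp [e2]
    generalize e2 G (U \ (S ∪ nb G U S)) = eA at *
    generalize (U \ (S ∪ nb G U S)).card = a at *
    generalize (nb G U S).card = w at *
    generalize S.card = σ at *
    generalize e2 G U = eU at *
    have hw : w = D + j := by omega
    have hσ : σ ≤ j := by omega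
    obtain ⟨r, rfl⟩ := Nat.exists_eq_add_of_le hσ
    rw [hj, ← hcard]
    subst hw
    nlinarith [Nat.zero_le (D * r), Nat.zero_le (σ * r), Nat.zero_le (r*r), Nat.mul_le_mul hSpos hSpos]
  have hQ2 := hQ.2 hi0
  by_cases hj2 : 2 ≤ j
  · have hsp := e2_split hSU hd ha2
    generalize e2 G (U \ (S ∪ nb G U S)) = eA at *
    generalize (U \ (S ∪ nb G U S)).card = a at *
    generalize (nb G U S).card = w at *
    generalize S.card = σ at *
    generalize e2 G U = eU at *
    have hij : i + 2 * σ ≤ j + 2 := by omega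
    have hw : w + i = D + j := by omega
    rw [hj, ← hcard]
    have key : (2:ℤ) * σ + D * j + j ^ 2 ≥ σ * D - i * D + (eA - 2 * a) + 2 + D + j := by
      have h1 : (eA : ℤ) + 1 ≤ 2 * a + i ^ 2 + 4 * i := by exact_mod_cast hQ2
      have c1 : (0:ℤ) ≤ (j:ℤ) - 1 - σ + i := by omega
      have c2 : (4:ℤ) ≤ D := by exact_mod_cast hD
      have hbig : ∀ e : ℤ, (4:ℤ) * (j - 1 - σ + i) + 2 * σ + j ^ 2 - j - 2 ≥ e →
          e ≥ eA - 2 * a → (2:ℤ) * σ + D * j + j ^ 2 ≥ σ * D - i * D + (eA - 2 * a) + 2 + D + j := by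
        intro e h h'
        nlinarith [mul_nonneg c1 (sub_nonneg.2 c2)]
      have hijz : (i:ℤ) + 2 * σ ≤ j + 2 := by exact_mod_cast hij
      have hσz : (1:ℤ) ≤ σ := by exact_mod_cast hSpos
      have hiz : (1:ℤ) ≤ i := by exact_mod_cast hi0
      by_cases hj3 : 3 ≤ j
      · have hj3z : (3:ℤ) ≤ j := by exact_mod_cast hj3
        apply hbig _ le_rfl
        have : (i:ℤ) ≤ j := by linarith
        nlinarith
      · have hj2' : j = 2 := by omega
        subst hj2'
        have hσ1 : σ = 1 := by omega
        subst hσ1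
        have hi2 : i = 1 ∨ i = 2 := by omega
        rcases hi2 with rfl | rfl
        · apply hbig _ le_rfl
          push_cast at h1 ⊢
          linarith
        · apply hbig _ le_rfl
          obtain ⟨r, hr⟩ := hev
          push_cast at h1 ⊢
          omega
    zify at hsp hw ⊢
    have hw' : (w:ℤ) = D + j - i := by linarith
    rw [hw'] at hsp ⊢
    nlinarith
  · have hj' : j = 1 := by omega
    subst hj'
    have hσ1 : S.card = 1 := by omega
    have hi1 : i = 1 := by omega
    subst hi1
    have hw : (nb G U S).card = D := by omega
    by_cases hall : ∀ w ∈ nb G U S, dg G (U \ (S ∪ nb G U S)) w ≤ 1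
    · have hsp := e2_split hSU hd hall
      rw [hσ1, hw] at hsp hcard
      rw [hj, ← hcard]
      nlinarith
    · push Not at hall
      obtain ⟨w0, hw0, hw1⟩ := hall
      have hw2 : dg G (U \ (S ∪ nb G U S)) w0 = 2 := by have := ha2 w0 hw0; omega
      have hsp := e2_split hSU hd ha2
      obtain ⟨hwU, hwS, s, hs, hsw⟩ := mem_nb.1 hw0
      have hnc := nb_insert_card hw0
      set A := U \ (S ∪ nb G U S) with hA
      set P := A.filter (G.Adj w0) with hPd
      have hPA : P ⊆ A := Finset.filter_subset _ _
      have hP2 : P.card = 2 := hw2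
      set S2 := insert w0 S with hS2
      have hS2c : Cn G S2 := Cn_insert hS hs hsw
      have hS2U : S2 ⊆ U := Finset.insert_subset hwU hSU
      have hnl : (nb G U S2).card = l := by omega
      have hA2 : U \ (S2 ∪ nb G U S2) = A \ P := by
        ext v
        simp only [hA, hPd, hS2, Finset.mem_sdiff, Finset.mem_union, Finset.mem_filter, mem_nb,
          Finset.mem_insert, not_or, not_and, not_exists]
        constructor
        · rintro ⟨hv, ⟨h1, h2⟩, h3⟩
          refine ⟨⟨hv, h2, fun _ _ s' hs' => ?_⟩, fun _ => ?_⟩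
          · exact h3 hv ⟨h1, h2⟩ s' (Or.inr hs')
          · exact h3 hv ⟨h1, h2⟩ w0 (Or.inl rfl)
        · rintro ⟨⟨hv, h2, h3⟩, h4⟩
          refine ⟨hv, ⟨?_, h2⟩, ?_⟩
          · rintro rfl; exact h3 hwU hwS s hs hsw
          · rintro _ _ s' (rfl | hs')
            · exact h4 ⟨hv, h2, h3⟩
            · exact h3 hv h2 s' hs'
      have hQ' := (QQ hP _ U S2 0 le_rfl le_rfl hS2U hS2c
        (fun S' _ h2 h3 => by rw [hnl]; exact hLB S' h2 h3) (H1_of_Cn hU hS2U hS2c.1)).1 rfl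
      rw [hA2] at hQ'
      have hcA : (A \ P).card + 2 = A.card := by
        rw [← hP2]; exact Finset.card_sdiff_add_card_eq_card hPA
      have hQ'' := hQ' (Finset.card_pos.1 (by omega))
      have hdP : ∀ p ∈ P, dg G (A \ P) p ≤ 1 := by
        intro p hp
        have hpm := Finset.mem_filter.1 hp
        have hpU : p ∈ U := (Finset.mem_sdiff.1 hpm.1).1
        have hpS : p ∉ S := fun h => (Finset.mem_sdiff.1 hpm.1).2 (by simp [h])
        have hpn : p ∈ nb G U S2 := by
          rw [mem_nb]
          refine ⟨hpU, ?_, w0, by simp [hS2], hpm.2⟩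
          rw [hS2, Finset.mem_insert]
          rintro (h | h)
          · exact hpm.2.ne h.symm
          · exact hpS h
        have h1 := nb_insert_card hpn
        rw [hA2, hnl] at h1
        have := hLB (insert p S2) (Finset.insert_subset hpU hS2U)
          (Cn_insert hS2c (s := w0) (by simp [hS2]) hpm.2)
        omega
      have hsumP : ∑ p ∈ P, dg G (A \ P) p ≤ 2 := by
        have := Finset.sum_le_card_nsmul P (dg G (A \ P)) 1 hdP
        rw [hP2] at this
        simpa using this
      have heP : e2 G P ≤ 2 := by
        have : ∀ p ∈ P, dg G P p ≤ 1 := by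
          intro p hp
          have h1 : P.filter (G.Adj p) ⊆ P.erase p := by
            intro y hy
            rw [Finset.mem_filter] at hy
            exact Finset.mem_erase.2 ⟨hy.2.ne', hy.1⟩
          have h2 := Finset.card_le_card h1
          rw [Finset.card_erase_of_mem hp, hP2] at h2
          exact h2
        have h3 := e2_le_mul this
        omega
      have heA : e2 G A = e2 G (A \ P) + e2 G P + 2 * ∑ p ∈ P, dg G (A \ P) p := by
        conv_lhs => rw [← Finset.sdiff_union_of_subset hPA]
        exact e2_union Finset.sdiff_disjoint
      have heA' : e2 G A ≤ 2 * A.card := by omega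
      rw [hσ1, hw] at hsp hcard
      rw [hj, ← hcard]
      have e1 : (D + 1) ^ 2 = D * D + 2 * D + 1 := by ring
      have e3 : (1 + D) * D = D + D * D := by ring
      rw [e1]
      rw [e3] at hsp
      omega

theorem main_thm : ∀ (m : ℕ) (G : SimpleGraph V), PP G m := by
  intro m
  induction m with
  | zero => intro G U l _ h; omega
  | succ m ih =>
    intro G U l hl2 hm hU hLB hl
    rcases Nat.lt_succ_iff_lt_or_eq.1 hm with h | h
    · exact ih G U l hl2 h hU hLB hl
    subst h
    obtain ⟨x, hx, hmax⟩ := Finset.exists_max_image U (dg G U) hU.1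
    have hxl := hLB.dg_le hx
    rcases Nat.lt_or_eq_of_le hxl with hlt | heq
    · by_cases h2 : dg G U x ≤ 2
      · have h1 := e2_le_mul (fun v hv => (hmax v hv).trans h2)
        nlinarith
      by_cases h3 : dg G U x = 3
      · exact lem_d3 ih hU (by omega) hLB hl (fun v hv => h3 ▸ hmax v hv) hx h3
      · exact lem_big (ih G) hU hLB hx rfl hmax (by omega) hlt hl
    · exact lem_j0 (ih G) hU hLB hx heq hl

end DJS

namespace DJS
open scoped Classical
variable {V : Type} {G : SimpleGraph V}

lemma Cn_univ [Fintype V] (hG : G.Connected) : Cn G Finset.univ := by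
  obtain ⟨v0⟩ := hG.nonempty
  refine ⟨⟨v0, Finset.mem_univ _⟩, ?_⟩
  intro T _ ⟨a, ha⟩ hne
  obtain ⟨b, hb⟩ : ∃ b, b ∉ T := by
    by_contra h; push Not at h; exact hne (by ext; simp [h])
  obtain ⟨p⟩ := hG.preconnected a b
  obtain ⟨d, _, h1, h2⟩ := p.exists_boundary_dart (T : Set V) (by simpa using ha) (by simpa using hb)
  exact ⟨d.fst, by simpa using h1, d.snd, by simp, by simpa using h2, d.adj⟩

lemma e2_univ [Fintype V] : e2 G Finset.univ = 2 * G.edgeSet.ncard := by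
  have h := G.sum_degrees_eq_twice_card_edges
  rw [Set.ncard_eq_toFinset_card']
  change _ = 2 * G.edgeFinset.card
  rw [← h]
  unfold e2 dg
  refine Finset.sum_congr rfl fun v _ => ?_
  rw [← G.card_neighborFinset_eq_degree v]
  congr 1
  ext y; simp

/-- a few edges that connect everything through `D` -/
lemma span_step [Fintype V] {D : Finset V} (hD : Cn G D) (hdom : ∀ v, v ∉ D → ∃ d ∈ D, G.Adj d v) :
    ∀ (N : ℕ) (B : Finset V) (F : Finset (Sym2 V)), Fintype.card V ≤ B.card + N →
    (B ∩ D).Nonempty → F.card + 1 ≤ B.card →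
    (∀ u ∈ B, ∀ v ∈ B, ∃ p : G.Walk u v, (∀ e ∈ p.edges, e ∈ F) ∧
      ∀ x ∈ p.support, x ∈ D ∨ x = u ∨ x = v) →
    ∃ F : Finset (Sym2 V), F.card + 1 ≤ Fintype.card V ∧
      ∀ u v, ∃ p : G.Walk u v, (∀ e ∈ p.edges, e ∈ F) ∧
      ∀ x ∈ p.support, x ∈ D ∨ x = u ∨ x = v := by
  intro N
  induction N with
  | zero =>
    intro B F hN hBD hF hw
    have hB : B = Finset.univ := by
      rw [← Finset.card_eq_iff_eq_univ]
      exact le_antisymm (Finset.card_le_univ B) (by omega)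
    subst hB
    exact ⟨F, by simpa using hF, fun u v => hw u (by simp) v (by simp)⟩
  | succ N ih =>
    intro B F hN hBD hF hw
    by_cases hB : B = Finset.univ
    · subst hB
      exact ⟨F, by simpa using hF, fun u v => hw u (by simp) v (by simp)⟩
    obtain ⟨d, hdB, hdD, b, hbB, hdb⟩ : ∃ d ∈ B, d ∈ D ∧ ∃ b, b ∉ B ∧ G.Adj d b := by
      by_cases h : B ∩ D = D
      · obtain ⟨b, hb⟩ : ∃ b, b ∉ B := by
          by_contra h; push Not at h; exact hB (by ext; simp [h])
        have hDB : D ⊆ B := Finset.inter_eq_right.1 h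
        obtain ⟨d, hd, hdb⟩ := hdom b (fun h => hb (hDB h))
        exact ⟨d, hDB hd, hd, b, hb, hdb⟩
      · obtain ⟨d, hd, b, hb, hbn, hdb⟩ := hD.2 (B ∩ D) Finset.inter_subset_right hBD h
        rw [Finset.mem_inter] at hd hbn
        exact ⟨d, hd.1, hd.2, b, fun h => hbn ⟨h, hb⟩, hdb⟩
    have hto : ∀ v ∈ B, ∃ p : G.Walk b v, (∀ e ∈ p.edges, e ∈ insert s(b, d) F) ∧
      ∀ x ∈ p.support, x ∈ D ∨ x = b ∨ x = v := by
      intro v hv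
      obtain ⟨p, hp1, hp2⟩ := hw d hdB v hv
      refine ⟨Walk.cons hdb.symm p, ?_, ?_⟩
      · intro e he
        rw [Walk.edges_cons, List.mem_cons] at he
        rw [Finset.mem_insert]
        rcases he with h | h
        · left; exact h
        · right; exact hp1 e h
      · intro x hx
        rw [Walk.support_cons, List.mem_cons] at hx
        rcases hx with h | h
        · right; left; exact h
        · rcases hp2 x h with h | h | h
          · left; exact h
          · left; rw [h]; exact hdD
          · right; right; exact h
    refine ih (insert b B) (insert s(b, d) F) ?_ ?_ ?_ ?_
    · rw [Finset.card_insert_of_notMem hbB]; omega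
    · exact ⟨d, by simp [hdB, hdD]⟩
    · rw [Finset.card_insert_of_notMem hbB]
      have := Finset.card_insert_le s(b, d) F
      omega
    · intro u hu v hv
      rw [Finset.mem_insert] at hu hv
      rcases hu with rfl | hu <;> rcases hv with rfl | hv
      · exact ⟨Walk.nil, by simp, by simp⟩
      · exact hto v hv
      · obtain ⟨p, hp1, hp2⟩ := hto u hu
        refine ⟨p.reverse, ?_, ?_⟩
        · intro e he
          rw [Walk.edges_reverse, List.mem_reverse] at he
          exact hp1 e he
        · intro x hx
          rw [Walk.support_reverse, List.mem_reverse] at hx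
          rcases hp2 x hx with h | h | h
          · exact Or.inl h
          · exact Or.inr (Or.inr h)
          · exact Or.inr (Or.inl h)
      · obtain ⟨p, hp1, hp2⟩ := hw u hu v hv
        exact ⟨p, fun e he => Finset.mem_insert_of_mem (hp1 e he), hp2⟩

lemma internal_ne {u v : V} (p : G.Walk u v) (hp : p.IsPath) {x : V}
    (hx : x ∈ p.support.tail.dropLast) : x ≠ u ∧ x ≠ v := by
  have hn := hp.support_nodup
  cases p with
  | nil => simp at hx
  | cons h q =>
    rw [Walk.support_cons] at hn hx
    simp only [List.tail_cons] at hx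
    rw [List.nodup_cons] at hn
    refine ⟨?_, ?_⟩
    · rintro rfl
      exact hn.1 (List.mem_of_mem_dropLast hx)
    · rintro rfl
      have h1 : q.support.dropLast ++ [q.support.getLast (by simp)] = q.support :=
        List.dropLast_append_getLast _
      rw [Walk.getLast_support] at h1
      have h2 := hn.2
      rw [← h1] at h2
      rw [List.nodup_append] at h2
      exact h2.2.2 x hx x (by simp) rfl

lemma internal_mem {u v : V} (p : G.Walk u v) {x : V}
    (hx : x ∈ p.support.tail.dropLast) : x ∈ p.support :=
  List.mem_of_mem_tail (List.mem_of_mem_dropLast hx)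

lemma colors_bdd [Fintype V] (G : SimpleGraph V) :
    BddAbove {k | ∃ ce cv, IsTMCColoring G ce cv ∧ colorsUsed G ce cv = k} := by
  refine ⟨G.edgeSet.ncard + Fintype.card V, ?_⟩
  rintro k ⟨ce, cv, _, rfl⟩
  unfold colorsUsed
  refine (Set.ncard_union_le _ _).trans ?_
  have h1 : (ce '' G.edgeSet).ncard ≤ G.edgeSet.ncard := Set.ncard_image_le (Set.toFinite _)
  have h2 : (Set.range cv).ncard ≤ Fintype.card V := by
    rw [← Set.image_univ, ← Nat.card_eq_fintype_card, ← Set.ncard_univ]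
    exact Set.ncard_image_le (Set.toFinite _)
  omega

lemma tmc_ge [Fintype V] {D : Finset V} {F : Finset (Sym2 V)} (hDne : D.Nonempty)
    (hF : ∀ u v, ∃ p : G.Walk u v, (∀ e ∈ p.edges, e ∈ F) ∧
      ∀ x ∈ p.support, x ∈ D ∨ x = u ∨ x = v) :
    G.edgeSet.ncard + Fintype.card V + 1 ≤ tmc G + F.card + D.card := by
  let enc := Fintype.equivFin (Sym2 V ⊕ V)
  let g : Sym2 V ⊕ V → ℕ := fun z => (enc z : ℕ) + 1
  have hg : Function.Injective g := by
    intro a b h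
    have : (enc a : ℕ) = enc b := by simpa [g] using h
    exact enc.injective (Fin.ext this)
  let ce : Sym2 V → ℕ := fun e => if e ∈ F then 0 else g (Sum.inl e)
  let cv : V → ℕ := fun x => if x ∈ D then 0 else g (Sum.inr x)
  have hT : IsTMCColoring G ce cv := by
    intro u v _
    obtain ⟨p, h1, h2⟩ := hF u v
    refine ⟨p.bypass, p.bypass_isPath, 0, ?_, ?_⟩
    · intro e he
      simp only [ce, if_pos (h1 e (p.edges_bypass_subset he))]
    · intro x hx
      have h3 := internal_ne _ p.bypass_isPath hx
      have h4 := h2 x (p.support_bypass_subset (internal_mem _ hx))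
      have h5 : x ∈ D := by tauto
      simp only [cv, if_pos h5]
  have hle : colorsUsed G ce cv ≤ tmc G := le_csSup (colors_bdd G) ⟨ce, cv, hT, rfl⟩
  let E := G.edgeFinset
  let Z : Finset ℕ := insert 0 (((E \ F).disjSum Dᶜ).image g)
  have hZ : Z.card = (E \ F).card + Dᶜ.card + 1 := by
    rw [Finset.card_insert_of_notMem (by simp [g]), Finset.card_image_of_injective _ hg,
      Finset.card_disjSum]
  have hsub : (Z : Set ℕ) ⊆ ce '' G.edgeSet ∪ Set.range cv := by
    intro c hc
    simp only [Z, Finset.coe_insert, Set.mem_insert_iff, Finset.mem_coe, Finset.mem_image] at hc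
    rcases hc with rfl | ⟨z, hz, rfl⟩
    · obtain ⟨d, hd⟩ := hDne
      right; exact ⟨d, by simp [cv, hd]⟩
    · rw [Finset.mem_disjSum] at hz
      rcases hz with ⟨e, he, rfl⟩ | ⟨x, hx, rfl⟩
      · left
        rw [Finset.mem_sdiff] at he
        exact ⟨e, by simpa [E] using he.1, by simp [ce, he.2]⟩
      · right
        rw [Finset.mem_compl] at hx
        exact ⟨x, by simp [cv, hx]⟩
  have h1 : Z.card ≤ colorsUsed G ce cv := by
    unfold colorsUsed
    rw [← Set.ncard_coe_finset Z]
    exact Set.ncard_le_ncard hsub (Set.toFinite _)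
  have h2 : G.edgeSet.ncard = E.card := by
    rw [Set.ncard_eq_toFinset_card']; rfl
  have h3 : E.card ≤ (E \ F).card + F.card := by
    have := Finset.le_card_sdiff F E
    omega
  have h4 := Finset.card_add_card_compl D
  omega

theorem partB [Fintype V] (hG : G.Connected) {n t k : ℕ} (hn : Fintype.card V = n) (ht : 2 ≤ t)
    (htn : t + 2 ≤ n) (hm : n + (t - 1).choose 2 ≤ G.edgeSet.ncard)
    (hk : k + n ≤ G.edgeSet.ncard + t + 2) : k ≤ tmc G := by
  have hU := Cn_univ hG
  have hcu : (Finset.univ : Finset V).card = n := by rw [Finset.card_univ, hn]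
  have hS : ∃ S, Cn G S ∧ t ≤ (nb G Finset.univ S).card := by
    by_contra hcon
    push Not at hcon
    obtain ⟨l, rfl⟩ : ∃ l, t = l + 1 := ⟨t - 1, by omega⟩
    have hLB : LB G Finset.univ l := fun S _ hS => Nat.lt_succ_iff.1 (hcon S hS)
    simp only [Nat.add_sub_cancel] at hm
    by_cases hl : l = 1
    · subst hl
      obtain ⟨z, hz⟩ := hU.1
      have := path_lem _ Finset.univ z rfl hU hz (fun T hT _ hc => hLB T hT hc)
      rw [e2_univ, hcu] at this
      omega
    · have := main_thm (n + 1) G Finset.univ l (by omega) (by omega) hU hLB (by omega)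
      rw [e2_univ, hcu] at this
      have h2 : 2 * l.choose 2 = l * (l - 1) := by
        rw [Nat.choose_two_right]
        exact Nat.mul_div_cancel' (Nat.even_mul_pred_self l).two_dvd
      obtain ⟨q, rfl⟩ : ∃ q, l = q + 1 := ⟨l - 1, by omega⟩
      simp only [Nat.add_sub_cancel] at h2
      nlinarith
  obtain ⟨S, hSc, hSt⟩ := hS
  obtain ⟨D, _, _, hD, hdom, hnb⟩ := grow hU n S (by omega) (Finset.subset_univ _) hSc
  have hcD := card_split (G := G) (Finset.subset_univ D)
  rw [hdom, hcu] at hcD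
  simp at hcD
  obtain ⟨d0, hd0⟩ := hD.1
  obtain ⟨F, hFc, hF⟩ := span_step hD (by
    intro v hv
    have : v ∈ D ∪ nb G Finset.univ D := by rw [hdom]; simp
    rcases Finset.mem_union.1 this with h | h
    · exact absurd h hv
    · exact (mem_nb.1 h).2.2) n {d0} ∅ (by omega) ⟨d0, by simp [hd0]⟩ (by simp) (by
      intro u hu v hv
      rw [Finset.mem_singleton] at hu hv
      subst hu; subst hv
      exact ⟨Walk.nil, by simp, by simp⟩)
  have := tmc_ge ⟨d0, hd0⟩ hF
  omega

end DJS

namespace DJS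
open scoped Classical
variable {V : Type} {G : SimpleGraph V} {ce : Sym2 V → ℕ} {cv : V → ℕ}

/-- subgraph of edges of colour `c` -/
def Gc (G : SimpleGraph V) (ce : Sym2 V → ℕ) (c : ℕ) : SimpleGraph V where
  Adj u v := G.Adj u v ∧ ce s(u, v) = c
  symm := ⟨by
    rintro u v ⟨h, h'⟩
    exact ⟨h.symm, by rw [Sym2.eq_swap]; exact h'⟩⟩
  loopless := ⟨fun u h => G.loopless.irrefl u h.1⟩

noncomputable def Ec [Fintype V] (G : SimpleGraph V) (ce : Sym2 V → ℕ) (c : ℕ) : ℕ :=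
  (G.edgeFinset.filter (fun e => ce e = c)).card

noncomputable def Vc [Fintype V] (cv : V → ℕ) (c : ℕ) : ℕ :=
  (Finset.univ.filter (fun x => cv x = c)).card

lemma lemE [Fintype V] {c : ℕ} {B : Finset V} {b0 : V}
    (h : ∀ b ∈ B, (Gc G ce c).Reachable b0 b) : B.card ≤ Ec G ce c + 1 := by
  have hpar : ∀ b : V, ∃ p : V, b ≠ b0 → (Gc G ce c).Reachable b0 b → (Gc G ce c).Adj p b ∧
      (Gc G ce c).dist b0 p < (Gc G ce c).dist b0 b := by
    intro b
    by_cases hb : b ≠ b0 ∧ (Gc G ce c).Reachable b0 b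
    · obtain ⟨w, hw⟩ := hb.2.symm.exists_walk_length_eq_dist
      cases w with
      | nil => exact absurd rfl hb.1
      | cons hadj p =>
        rename_i x
        refine ⟨x, fun _ _ => ⟨hadj.symm, ?_⟩⟩
        have h1 := SimpleGraph.dist_le p
        rw [Walk.length_cons] at hw
        rw [SimpleGraph.dist_comm, SimpleGraph.dist_comm (u := b0)]
        omega
    · exact ⟨b, fun h1 h2 => absurd ⟨h1, h2⟩ hb⟩
  choose par hp using hpar
  have h1 : (B.erase b0).card ≤ Ec G ce c := by
    unfold Ec
    apply Finset.card_le_card_of_injOn (fun b => s(par b, b))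
    · intro b hb
      have hb' := Finset.mem_erase.1 hb
      have := (hp b hb'.1 (h b hb'.2)).1
      simp only [Finset.coe_filter, Set.mem_setOf_eq, mem_edgeFinset, mem_edgeSet]
      exact this
    · intro b hb d hd hbd
      have hb' := Finset.mem_erase.1 hb
      have hd' := Finset.mem_erase.1 hd
      have e1 := (hp b hb'.1 (h b hb'.2)).2
      have e2 := (hp d hd'.1 (h d hd'.2)).2
      simp only [Sym2.eq_iff] at hbd
      rcases hbd with hh | hh
      · exact hh.2
      · rw [hh.1] at e1
        rw [← hh.2] at e2
        omega
  have := Finset.pred_card_le_card_erase (a := b0) (s := B)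
  omega

lemma lemCol [Fintype V] (K : Finset ℕ) :
    colorsUsed G ce cv + ∑ c ∈ K, (Ec G ce c + Vc cv c) ≤
      G.edgeSet.ncard + Fintype.card V + K.card := by
  have h2 : G.edgeSet.ncard = G.edgeFinset.card := by
    rw [Set.ncard_eq_toFinset_card']; rfl
  have hE : G.edgeFinset.card = (G.edgeFinset.filter (fun e => ce e ∉ K)).card
      + ∑ c ∈ K, Ec G ce c := by
    rw [← Finset.card_filter_add_card_filter_not (s := G.edgeFinset) (fun e => ce e ∈ K), add_comm]
    congr 1
    rw [Finset.card_eq_sum_card_fiberwise (f := ce) (t := K)]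
    · refine Finset.sum_congr rfl fun c hc => ?_
      unfold Ec
      rw [Finset.filter_filter]
      congr 1
      ext e; simp only [Finset.mem_filter]
      constructor
      · rintro ⟨h1, _, h3⟩; exact ⟨h1, h3⟩
      · rintro ⟨h1, h3⟩; exact ⟨h1, h3 ▸ hc, h3⟩
    · intro e he
      simpa using (Finset.mem_filter.1 he).2
  have hV : Fintype.card V = (Finset.univ.filter (fun x => cv x ∉ K)).card
      + ∑ c ∈ K, Vc cv c := by
    rw [← Finset.card_univ,
      ← Finset.card_filter_add_card_filter_not (s := (Finset.univ : Finset V)) (fun e => cv e ∈ K),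
      add_comm]
    congr 1
    rw [Finset.card_eq_sum_card_fiberwise (f := cv) (t := K)]
    · refine Finset.sum_congr rfl fun c hc => ?_
      unfold Vc
      rw [Finset.filter_filter]
      congr 1
      ext e; simp only [Finset.mem_filter]
      constructor
      · rintro ⟨h1, _, h3⟩; exact ⟨h1, h3⟩
      · rintro ⟨h1, h3⟩; exact ⟨h1, h3 ▸ hc, h3⟩
    · intro e he
      simpa using (Finset.mem_filter.1 he).2
  have hcol : colorsUsed G ce cv ≤ K.card + (G.edgeFinset.filter (fun e => ce e ∉ K)).card
      + (Finset.univ.filter (fun x => cv x ∉ K)).card := by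
    unfold colorsUsed
    have hsub : ce '' G.edgeSet ∪ Set.range cv ⊆ ((K ∪ (G.edgeFinset.filter (fun e => ce e ∉ K)).image ce
        ∪ (Finset.univ.filter (fun x => cv x ∉ K)).image cv : Finset ℕ) : Set ℕ) := by
      rintro c (⟨e, he, rfl⟩ | ⟨x, rfl⟩)
      · simp only [Finset.coe_union, Set.mem_union, Finset.mem_coe]
        by_cases h : ce e ∈ K
        · exact Or.inl (Or.inl h)
        · exact Or.inl (Or.inr (Finset.mem_image_of_mem _ (by
            rw [Finset.mem_filter, mem_edgeFinset]; exact ⟨he, h⟩)))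
      · simp only [Finset.coe_union, Set.mem_union, Finset.mem_coe]
        by_cases h : cv x ∈ K
        · exact Or.inl (Or.inl h)
        · exact Or.inr (Finset.mem_image_of_mem _ (by simp [h]))
    refine (Set.ncard_le_ncard hsub (Set.toFinite _)).trans ?_
    rw [Set.ncard_coe_finset]
    refine (Finset.card_union_le _ _).trans ?_
    refine Nat.add_le_add ((Finset.card_union_le _ _).trans ?_) Finset.card_image_le
    exact Nat.add_le_add_left Finset.card_image_le _
  rw [Finset.sum_add_distrib]
  omega

/-- monochromatic path, convenient form -/
def MP (ce : Sym2 V → ℕ) (cv : V → ℕ) (c : ℕ) {u v : V} (p : G.Walk u v) : Prop :=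
  p.IsPath ∧ (∀ e ∈ p.edges, ce e = c) ∧ ∀ x ∈ p.support, x = u ∨ x = v ∨ cv x = c

lemma MP_of {u v : V} {p : G.Walk u v} (hp : p.IsPath) (hm : IsTotalMonoWalk ce cv p) :
    ∃ c, MP ce cv c p := by
  obtain ⟨c, h1, h2⟩ := hm
  refine ⟨c, hp, h1, ?_⟩
  intro x hx
  by_cases hu : x = u
  · exact Or.inl hu
  by_cases hv : x = v
  · exact Or.inr (Or.inl hv)
  refine Or.inr (Or.inr (h2 x ?_))
  have e1 : x ∈ p.support.tail := by
    rcases (Walk.mem_support_iff p).1 hx with h | h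
    · exact absurd h hu
    · exact h
  have hne : p.support.tail ≠ [] := List.ne_nil_of_mem e1
  have e2 : p.support.tail.dropLast ++ [p.support.tail.getLast hne] = p.support.tail :=
    List.dropLast_append_getLast _
  rw [← e2, List.mem_append] at e1
  rcases e1 with h | h
  · exact h
  · rw [List.mem_singleton, List.getLast_tail, Walk.getLast_support] at h
    exact absurd h hv

lemma MP.reach {u v : V} {c : ℕ} {p : G.Walk u v} (h : ∀ e ∈ p.edges, ce e = c) :
    (Gc G ce c).Reachable u v := by
  induction p with
  | nil => exact Reachable.refl _
  | cons hadj p ih =>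
    rw [Walk.edges_cons] at h
    have h1 := ih (fun e he => h e (List.mem_cons_of_mem _ he))
    have h2 : (Gc G ce c).Adj _ _ := ⟨hadj, h _ List.mem_cons_self⟩
    exact h2.reachable.trans h1

lemma MP.tail {u v w : V} {c : ℕ} {h : G.Adj u v} {p : G.Walk v w}
    (hm : MP ce cv c (Walk.cons h p)) : MP ce cv c p ∧ u ∉ p.support ∧ ce s(u, v) = c ∧
      ∀ x ∈ p.support, x = w ∨ cv x = c := by
  obtain ⟨h1, h2, h3⟩ := hm
  rw [Walk.cons_isPath_iff] at h1
  have h4 : ∀ x ∈ p.support, x = w ∨ cv x = c := by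
    intro x hx
    rcases h3 x (by rw [Walk.support_cons]; exact List.mem_cons_of_mem _ hx) with h | h
    · exact absurd (h ▸ hx) h1.2
    · exact h
  refine ⟨⟨h1.1, ?_, fun x hx => Or.inr (h4 x hx)⟩, h1.2, ?_, h4⟩
  · intro e he
    exact h2 e (by rw [Walk.edges_cons]; exact List.mem_cons_of_mem _ he)
  · exact h2 _ (by rw [Walk.edges_cons]; exact List.mem_cons_self)

structure Lad (G : SimpleGraph V) (r : ℕ) (q : ℕ → V) (X : Finset V) : Prop where
  inj : ∀ i ≤ r + 1, ∀ j ≤ r + 1, q i = q j → i = j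
  qX : ∀ i ≤ r + 1, q i ∉ X
  adj : ∀ i ≤ r, G.Adj (q i) (q (i + 1))
  mid : ∀ i, i + 1 ≤ r → ∀ y, G.Adj (q (i + 1)) y → y = q i ∨ y = q (i + 2)
  lft : ∀ y, G.Adj (q 0) y → y ∈ X ∨ y = q 1
  rgt : ∀ y, G.Adj (q (r + 1)) y → y ∈ X ∨ y = q r

lemma Lad.rev {r : ℕ} {q : ℕ → V} {X : Finset V} (L : Lad G r q X) :
    Lad G r (fun i => q (r + 1 - i)) X where
  inj i hi j hj h := by
    have := L.inj (r + 1 - i) (by omega) (r + 1 - j) (by omega) h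
    omega
  qX i hi := L.qX _ (by omega)
  adj i hi := by
    have := (L.adj (r - i) (by omega)).symm
    have e1 : r - i + 1 = r + 1 - i := by omega
    have e2 : r + 1 - (i + 1) = r - i := by omega
    rw [e1] at this
    simp only [e2]
    exact this
  mid i hi y hy := by
    have e1 : r + 1 - (i + 1) = (r - i - 1) + 1 := by omega
    simp only [e1] at hy
    have := L.mid (r - i - 1) (by omega) y hy
    have e2 : r - i - 1 + 2 = r + 1 - i := by omega
    have e3 : r - i - 1 = r + 1 - (i + 2) := by omega
    rw [e2, e3] at this
    exact this.symm
  lft y hy := by simpa using L.rgt y (by simpa using hy)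
  rgt y hy := by
    have e : r + 1 - r = 1 := by omega
    simpa [e] using L.lft y (by simpa using hy)

lemma ray_left {r : ℕ} {q : ℕ → V} {X : Finset V} (L : Lad G r q X) {c : ℕ} {z : V} :
    ∀ (i : ℕ) (p : G.Walk (q i) z), i ≤ r → MP ce cv c p → q (i + 1) ∉ p.support →
    (∀ l, 1 ≤ l → l ≤ i → z ≠ q l) →
    (∀ l < i, ce s(q l, q (l + 1)) = c ∧ (q l ≠ z → cv (q l) = c)) ∧
    (z ≠ q 0 → ∃ y ∈ X, y = z ∨ cv y = c) := by
  intro i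
  induction i with
  | zero =>
    intro p _ hm hn _
    refine ⟨fun l hl => absurd hl (by omega), fun hz => ?_⟩
    cases p with
    | nil => exact absurd rfl hz
    | cons h p =>
      rename_i u
      obtain ⟨h1, h2, h3, h4⟩ := hm.tail
      have hu : u ∈ p.support := p.start_mem_support
      rcases L.lft u h with hX | hq
      · exact ⟨u, hX, h4 u hu⟩
      · exfalso
        apply hn
        rw [Walk.support_cons, ← hq]
        exact List.mem_cons_of_mem _ hu
  | succ i ih =>
    intro p hi hm hn hz
    cases p with
    | nil => exact absurd rfl (hz (i + 1) (by omega) le_rfl)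
    | cons h p =>
      rename_i u
      obtain ⟨h1, h2, h3, h4⟩ := hm.tail
      have hu : u ∈ p.support := p.start_mem_support
      rcases L.mid i hi u h with hq | hq
      · subst hq
        obtain ⟨g1, g2⟩ := ih p (by omega) h1 h2 (fun l k1 k2 => hz l k1 (by omega))
        refine ⟨?_, g2⟩
        intro l hl
        rcases Nat.lt_succ_iff_lt_or_eq.1 hl with hl | rfl
        · exact g1 l hl
        · refine ⟨by rw [Sym2.eq_swap]; exact h3, fun hne => ?_⟩
          rcases h4 _ hu with h | h
          · exact absurd h hne
          · exact h
      · exfalso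
        apply hn
        rw [Walk.support_cons, ← hq]
        exact List.mem_cons_of_mem _ hu

lemma ray_right {r : ℕ} {q : ℕ → V} {X : Finset V} (L : Lad G r q X) {c : ℕ} {z : V}
    (i : ℕ) (p : G.Walk (q i) z) (hi0 : 1 ≤ i) (hi : i ≤ r + 1) (hm : MP ce cv c p)
    (hn : q (i - 1) ∉ p.support) (hz : ∀ l, i ≤ l → l ≤ r → z ≠ q l) :
    (∀ l, i ≤ l → l ≤ r → ce s(q l, q (l + 1)) = c ∧ (q (l + 1) ≠ z → cv (q (l + 1)) = c)) := by
  obtain ⟨j, hj, rfl⟩ : ∃ j, j ≤ r ∧ i = r + 1 - j := ⟨r + 1 - i, by omega, by omega⟩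
  have k := (ray_left (ce := ce) (cv := cv) (c := c) (z := z) L.rev j p hj hm
    (by
      have e1 : r + 1 - (j + 1) = r + 1 - j - 1 := by omega
      beta_reduce
      rw [e1]; exact hn)
    (fun l k1 k2 => hz _ (by omega) (by omega))).1
  intro l h1 h2
  have := k (r - l) (by omega)
  have e2 : r + 1 - (r - l) = l + 1 := by omega
  have e3 : r + 1 - (r - l + 1) = l := by omega
  beta_reduce at this
  rw [e2, e3, Sym2.eq_swap] at this
  exact this

def LO (ce : Sym2 V → ℕ) (cv : V → ℕ) (q : ℕ → V) (i c : ℕ) : Prop :=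
  ∀ l < i, ce s(q l, q (l + 1)) = c ∧ cv (q l) = c

def RO (ce : Sym2 V → ℕ) (cv : V → ℕ) (q : ℕ → V) (r i c : ℕ) : Prop :=
  ∀ l, i ≤ l → l ≤ r → ce s(q l, q (l + 1)) = c ∧ cv (q (l + 1)) = c

lemma RO_rev {r : ℕ} {q : ℕ → V} {i c : ℕ} (h : RO ce cv (fun i => q (r + 1 - i)) r i c) :
    LO ce cv q (r + 1 - i) c := by
  intro l hl
  have := h (r - l) (by omega) (by omega)
  have e2 : r + 1 - (r - l) = l + 1 := by omega
  have e3 : r + 1 - (r - l + 1) = l := by omega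
  beta_reduce at this
  rw [e2, e3, Sym2.eq_swap] at this
  exact this

lemma LO_rev {r : ℕ} {q : ℕ → V} {i c : ℕ} (h : LO ce cv (fun i => q (r + 1 - i)) i c) :
    RO ce cv q r (r + 1 - i) c := by
  intro l hl hl2
  have := h (r - l) (by omega)
  have e2 : r + 1 - (r - l) = l + 1 := by omega
  have e3 : r + 1 - (r - l + 1) = l := by omega
  beta_reduce at this
  rw [e2, e3, Sym2.eq_swap] at this
  exact this

lemma side {r : ℕ} {q : ℕ → V} {X : Finset V} (L : Lad G r q X) (hT : IsTMCColoring G ce cv)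
    {i : ℕ} (hi0 : 1 ≤ i) (hi : i ≤ r) {z : V} (hz : z ∈ X ∨ z = q (r + 1)) :
    ∃ c, (Gc G ce c).Reachable (q i) z ∧ ((LO ce cv q i c ∧ ∃ y ∈ X, y = z ∨ cv y = c) ∨
      (∀ l, i ≤ l → l ≤ r → ce s(q l, q (l + 1)) = c ∧ (q (l + 1) ≠ z → cv (q (l + 1)) = c))) := by
  have hzq : ∀ l, l ≤ r → z ≠ q l := by
    rintro l hl rfl
    rcases hz with h | h
    · exact L.qX l (by omega) h
    · have := L.inj _ (by omega) _ (by omega) h; omega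
  obtain ⟨p, hp, hpm⟩ := hT (q i) z (hzq i hi).symm
  obtain ⟨c, hm⟩ := MP_of hp hpm
  refine ⟨c, MP.reach hm.2.1, ?_⟩
  obtain ⟨i, rfl⟩ : ∃ i', i = i' + 1 := ⟨i - 1, by omega⟩
  cases p with
  | nil => exact absurd rfl (hzq _ hi)
  | cons h p =>
    rename_i u
    obtain ⟨h1, h2, h3, h4⟩ := hm.tail
    have hu : u ∈ p.support := p.start_mem_support
    rcases L.mid i hi u h with hq | hq
    · subst hq
      left
      obtain ⟨g1, g2⟩ := ray_left L i p (by omega) h1 h2 (fun l _ k2 => hzq l (by omega))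
      refine ⟨?_, g2 (hzq 0 (by omega))⟩
      intro l hl
      have hne := (hzq l (by omega)).symm
      rcases Nat.lt_succ_iff_lt_or_eq.1 hl with hl | rfl
      · exact ⟨(g1 l hl).1, (g1 l hl).2 hne⟩
      · refine ⟨by rw [Sym2.eq_swap]; exact h3, ?_⟩
        rcases h4 _ hu with h | h
        · exact absurd h hne
        · exact h
    · subst hq
      right
      have g := ray_right L (i + 2) p (by omega) (by omega) h1 (by simpa using h2)
        (fun l _ k2 => hzq l (by omega))
      intro l k1 k2
      rcases Nat.eq_or_lt_of_le k1 with rfl | k1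
      · refine ⟨h3, fun hne => ?_⟩
        rcases h4 _ hu with h | h
        · exact absurd h hne
        · exact h
      · exact g l k1 k2

lemma sideX {r : ℕ} {q : ℕ → V} {X : Finset V} (L : Lad G r q X) (hT : IsTMCColoring G ce cv)
    {i : ℕ} (hi0 : 1 ≤ i) (hi : i ≤ r) {z : V} (hz : z ∈ X) :
    ∃ c, (Gc G ce c).Reachable (q i) z ∧ (LO ce cv q i c ∨ RO ce cv q r i c) := by
  obtain ⟨c, h1, h2⟩ := side L hT hi0 hi (Or.inl hz)
  refine ⟨c, h1, ?_⟩
  rcases h2 with h | h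
  · exact Or.inl h.1
  · right
    intro l k1 k2
    refine ⟨(h l k1 k2).1, (h l k1 k2).2 ?_⟩
    intro h'
    exact L.qX (l + 1) (by omega) (h' ▸ hz)

/-- the path between the two ends -/
lemma ends {r : ℕ} {q : ℕ → V} {X : Finset V} (L : Lad G r q X) (hT : IsTMCColoring G ce cv) :
    ∃ c, (Gc G ce c).Reachable (q 0) (q (r + 1)) ∧
      ((∀ l, l ≤ r → ce s(q l, q (l + 1)) = c ∧ (l < r → cv (q (l + 1)) = c)) ∨
       (∃ y ∈ X, cv y = c ∧ (Gc G ce c).Reachable (q 0) y)) := by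
  have hne : q 0 ≠ q (r + 1) := fun h => by
    have := L.inj _ (by omega) _ (by omega) h; omega
  obtain ⟨p, hp, hpm⟩ := hT (q 0) (q (r + 1)) hne
  obtain ⟨c, hm⟩ := MP_of hp hpm
  refine ⟨c, MP.reach hm.2.1, ?_⟩
  generalize hz : q (r + 1) = z at *
  cases p with
  | nil => exact absurd rfl hne
  | cons h p =>
    rename_i u
    obtain ⟨h1, h2, h3, h4⟩ := hm.tail
    have hu : u ∈ p.support := p.start_mem_support
    rcases L.lft u h with hq | hq
    · right
      refine ⟨u, hq, ?_, ?_⟩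
      · rcases h4 u hu with h | h
        · exact absurd hq (by rw [h, ← hz]; exact L.qX _ le_rfl)
        · exact h
      · have : (Gc G ce c).Adj (q 0) u := ⟨h, h3⟩
        exact this.reachable
    · subst hq
      left
      have g := ray_right L 1 p le_rfl (by omega) h1 (by simpa using h2) (by
        intro l _ k2 h'
        rw [← hz] at h'
        have := L.inj _ (by omega) _ (by omega) h'; omega)
      have hne' : ∀ l, l < r → q (l + 1) ≠ z := by
        intro l hl h'
        rw [← hz] at h'
        have := L.inj _ (by omega) _ (by omega) h'; omega
      intro l k2
      rcases Nat.eq_zero_or_pos l with rfl | k1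
      · refine ⟨h3, fun hlt => ?_⟩
        rcases h4 _ hu with h | h
        · exact absurd h (hne' 0 hlt)
        · exact h
      · exact ⟨(g l k1 k2).1, fun hlt => (g l k1 k2).2 (hne' l hlt)⟩

end DJS

namespace DJS
open scoped Classical
variable {V : Type} {G : SimpleGraph V} {ce : Sym2 V → ℕ} {cv : V → ℕ}

lemma Lad.card {r : ℕ} {q : ℕ → V} {X : Finset V} (L : Lad G r q X) {X' : Finset V} {S : Finset ℕ}
    (hX : X' ⊆ X) (hS : ∀ i ∈ S, i ≤ r + 1) : (X' ∪ S.image q).card = X'.card + S.card := by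
  rw [Finset.card_union_of_disjoint, Finset.card_image_of_injOn]
  · intro i hi j hj h
    exact L.inj i (hS i hi) j (hS j hj) h
  · rw [Finset.disjoint_left]
    intro x hx hx'
    obtain ⟨i, hi, rfl⟩ := Finset.mem_image.1 hx'
    exact L.qX i (hS i hi) (hX hx)

lemma Lad.EB [Fintype V] {r : ℕ} {q : ℕ → V} {X : Finset V} (L : Lad G r q X) {X' : Finset V}
    {S : Finset ℕ} (hX : X' ⊆ X) (hS : ∀ i ∈ S, i ≤ r + 1) {c : ℕ} (b0 : V)
    (h1 : ∀ x ∈ X', (Gc G ce c).Reachable b0 x) (h2 : ∀ i ∈ S, (Gc G ce c).Reachable b0 (q i)) :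
    X'.card + S.card ≤ Ec G ce c + 1 := by
  rw [← L.card hX hS]
  apply lemE (b0 := b0)
  intro b hb
  rcases Finset.mem_union.1 hb with h | h
  · exact h1 b h
  · obtain ⟨i, hi, rfl⟩ := Finset.mem_image.1 h
    exact h2 i hi

lemma Lad.VB [Fintype V] {r : ℕ} {q : ℕ → V} {X : Finset V} (L : Lad G r q X) {X' : Finset V}
    {S : Finset ℕ} (hX : X' ⊆ X) (hS : ∀ i ∈ S, i ≤ r + 1) {c : ℕ}
    (h1 : ∀ x ∈ X', cv x = c) (h2 : ∀ i ∈ S, cv (q i) = c) :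
    X'.card + S.card ≤ Vc cv c := by
  rw [← L.card hX hS]
  apply Finset.card_le_card
  intro b hb
  rw [Finset.mem_filter]
  refine ⟨Finset.mem_univ _, ?_⟩
  rcases Finset.mem_union.1 hb with h | h
  · exact h1 b h
  · obtain ⟨i, hi, rfl⟩ := Finset.mem_image.1 h
    exact h2 i hi

lemma Lad.LOr {r : ℕ} {q : ℕ → V} {X : Finset V} (L : Lad G r q X) {i c : ℕ} (hi : i ≤ r + 1)
    (h : LO ce cv q i c) : ∀ l ≤ i, (Gc G ce c).Reachable (q 0) (q l) := by
  intro l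
  induction l with
  | zero => intro _; exact Reachable.refl _
  | succ l ih =>
    intro hl
    have h1 : (Gc G ce c).Adj (q l) (q (l + 1)) := ⟨L.adj l (by omega), (h l (by omega)).1⟩
    exact (ih (by omega)).trans h1.reachable

lemma Lad.ROr {r : ℕ} {q : ℕ → V} {X : Finset V} (L : Lad G r q X) {i c : ℕ}
    (h : RO ce cv q r i c) : ∀ l, i ≤ l → l ≤ r + 1 → (Gc G ce c).Reachable (q i) (q l) := by
  intro l hl
  induction l, hl using Nat.le_induction with
  | base => intro _; exact Reachable.refl _
  | succ l hl ih =>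
    intro hl'
    have h1 : (Gc G ce c).Adj (q l) (q (l + 1)) := ⟨L.adj l (by omega), (h l hl (by omega)).1⟩
    exact (ih (by omega)).trans h1.reachable

lemma caseA [Fintype V] {r : ℕ} {q : ℕ → V} {X : Finset V} (L : Lad G r q X)
    (hT : IsTMCColoring G ce cv) (hr : 1 ≤ r) (hX : X.Nonempty)
    (h1 : ¬ ∃ c, LO ce cv q r c) (h2 : ¬ ∃ c, RO ce cv q r 1 c) :
    colorsUsed G ce cv + X.card + 2 * r + 1 ≤ G.edgeSet.ncard + Fintype.card V := by
  obtain ⟨j, hjr, ⟨a, hj⟩, hj'⟩ : ∃ j < r, (∃ c, LO ce cv q j c) ∧ ¬ ∃ c, LO ce cv q (j + 1) c := by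
    by_contra hcon
    push Not at hcon
    apply h1
    have : ∀ j ≤ r, ∃ c, LO ce cv q j c := by
      intro j
      induction j with
      | zero => intro _; exact ⟨0, fun l hl => absurd hl (by omega)⟩
      | succ j ih => intro h; exact hcon j (by omega) (ih (by omega))
    exact this r le_rfl
  have hXa0 : ∀ x ∈ X, ∃ c, (Gc G ce c).Reachable (q 1) x ∧ LO ce cv q 1 c := by
    intro x hx
    obtain ⟨c, k1, k2⟩ := sideX L hT le_rfl hr hx
    rcases k2 with k2 | k2
    · exact ⟨c, k1, k2⟩
    · exact absurd ⟨c, k2⟩ h2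
  have hj0 : 1 ≤ j := by
    obtain ⟨x, hx⟩ := hX
    obtain ⟨c, _, k⟩ := hXa0 x hx
    by_contra h
    have : j = 0 := by omega
    subst this
    exact hj' ⟨c, k⟩
  have hXb0 : ∀ x ∈ X, ∃ c, (Gc G ce c).Reachable (q (j + 1)) x ∧ RO ce cv q r (j + 1) c := by
    intro x hx
    obtain ⟨c, k1, k2⟩ := sideX L hT (by omega : 1 ≤ j + 1) (by omega) hx
    rcases k2 with k2 | k2
    · exact absurd ⟨c, k2⟩ hj'
    · exact ⟨c, k1, k2⟩
  obtain ⟨b, hb⟩ : ∃ b, RO ce cv q r (j + 1) b := by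
    obtain ⟨x, hx⟩ := hX
    obtain ⟨c, _, k⟩ := hXb0 x hx
    exact ⟨c, k⟩
  have hLa : ∀ c, LO ce cv q 1 c → c = a := fun c h => by
    rw [← (h 0 (by omega)).1, ← (hj 0 (by omega)).1]
  have hRb : ∀ c, RO ce cv q r (j + 1) c → c = b := fun c h => by
    rw [← (h r (by omega) le_rfl).1, ← (hb r (by omega) le_rfl).1]
  have hXa : ∀ x ∈ X, (Gc G ce a).Reachable (q 1) x := by
    intro x hx
    obtain ⟨c, k1, k2⟩ := hXa0 x hx
    rw [hLa c k2] at k1; exact k1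
  have hXb : ∀ x ∈ X, (Gc G ce b).Reachable (q (j + 1)) x := by
    intro x hx
    obtain ⟨c, k1, k2⟩ := hXb0 x hx
    rw [hRb c k2] at k1; exact k1
  obtain ⟨y, hyX, hya, hva⟩ : ∃ y ∈ X, cv y = a ∧ (Gc G ce a).Reachable (q 1) (q (r + 1)) := by
    obtain ⟨c, k1, k2⟩ := side L hT le_rfl hr (z := q (r + 1)) (Or.inr rfl)
    rcases k2 with ⟨k2, y, hy, hy'⟩ | k2
    · have := hLa c k2
      subst this
      rcases hy' with rfl | hy'
      · exact absurd hy (L.qX _ le_rfl)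
      · exact ⟨y, hy, hy', k1⟩
    · exfalso
      apply h2
      refine ⟨c, fun l l1 l2 => ⟨(k2 l l1 l2).1, ?_⟩⟩
      by_cases hlr : l = r
      · subst hlr
        rw [← (k2 l l1 l2).1, (hb l (by omega) l2).1]
        exact (hb l (by omega) l2).2
      · refine (k2 l l1 l2).2 fun h => ?_
        have := L.inj _ (by omega) _ (by omega) h
        omega
  have ha0 := L.LOr (by omega) hj
  have hb0 := L.ROr hb
  by_cases hab : a = b
  · subst hab
    have E := L.EB (ce := ce) (c := a) (X' := X) (S := Finset.range (r + 2)) le_rfl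
      (fun i hi => by rw [Finset.mem_range] at hi; omega) (q 1) hXa (by
        intro i hi
        rw [Finset.mem_range] at hi
        have h01 := (ha0 1 hj0).symm
        by_cases hij : i ≤ j
        · exact h01.trans (ha0 i hij)
        · obtain ⟨x, hx⟩ := hX
          exact (hXa x hx).trans ((hXb x hx).symm.trans (hb0 i (by omega) (by omega))))
    have W := L.VB (cv := cv) (c := a) (X' := {y}) (S := Finset.range j ∪ Finset.Icc (j + 2) (r + 1))
      (by simpa using hyX)
      (fun i hi => by rw [Finset.mem_union, Finset.mem_range, Finset.mem_Icc] at hi; omega)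
      (by simpa using hya) (by
        intro i hi
        rw [Finset.mem_union, Finset.mem_range, Finset.mem_Icc] at hi
        rcases hi with hi | hi
        · exact (hj i hi).2
        · obtain ⟨i, rfl⟩ : ∃ i', i = i' + 1 := ⟨i - 1, by omega⟩
          exact (hb i (by omega) (by omega)).2)
    rw [Finset.card_union_of_disjoint (by
      rw [Finset.disjoint_left]; intro i h1 h2
      rw [Finset.mem_range] at h1; rw [Finset.mem_Icc] at h2; omega)] at W
    have C := lemCol (G := G) (ce := ce) (cv := cv) {a}
    simp only [Finset.card_range, Nat.card_Icc, Finset.card_singleton, Finset.sum_singleton] at E W C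
    omega
  · have E := L.EB (ce := ce) (c := a) (X' := X) (S := insert (r + 1) (Finset.range (j + 1))) le_rfl
      (fun i hi => by rw [Finset.mem_insert, Finset.mem_range] at hi; omega) (q 1) hXa (by
        intro i hi
        rw [Finset.mem_insert, Finset.mem_range] at hi
        rcases hi with rfl | hi
        · exact hva
        · exact (ha0 1 hj0).symm.trans (ha0 i (by omega)))
    rw [Finset.card_insert_of_notMem (by rw [Finset.mem_range]; omega)] at E
    have W := L.VB (cv := cv) (c := a) (X' := {y}) (S := Finset.range j)
      (by simpa using hyX)
      (fun i hi => by rw [Finset.mem_range] at hi; omega)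
      (by simpa using hya) (by
        intro i hi
        rw [Finset.mem_range] at hi
        exact (hj i hi).2)
    have E' := L.EB (ce := ce) (c := b) (X' := X) (S := Finset.Icc (j + 1) (r + 1)) le_rfl
      (fun i hi => by rw [Finset.mem_Icc] at hi; omega) (q (j + 1)) hXb (by
        intro i hi
        rw [Finset.mem_Icc] at hi
        exact hb0 i hi.1 hi.2)
    have W' := L.VB (cv := cv) (c := b) (X' := ∅) (S := Finset.Icc (j + 2) (r + 1))
      (by simp)
      (fun i hi => by rw [Finset.mem_Icc] at hi; omega)
      (by simp) (by
        intro i hi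
        rw [Finset.mem_Icc] at hi
        obtain ⟨i, rfl⟩ : ∃ i', i = i' + 1 := ⟨i - 1, by omega⟩
        exact (hb i (by omega) (by omega)).2)
    have C := lemCol (G := G) (ce := ce) (cv := cv) {a, b}
    rw [Finset.sum_pair hab, Finset.card_pair hab] at C
    have := hX.card_pos
    simp only [Finset.card_range, Nat.card_Icc, Finset.card_singleton, Finset.card_empty] at E W E' W'
    omega

lemma caseB [Fintype V] {r : ℕ} {q : ℕ → V} {X : Finset V} (L : Lad G r q X)
    (hT : IsTMCColoring G ce cv) (hr : 1 ≤ r)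
    (h1 : ¬ ∃ c, LO ce cv q r c) (h2 : ∃ c, RO ce cv q r 1 c) :
    colorsUsed G ce cv + X.card + 2 * r + 1 ≤ G.edgeSet.ncard + Fintype.card V := by
  obtain ⟨b, hb⟩ := h2
  have hb0 := L.ROr hb
  have hXb : ∀ x ∈ X, (Gc G ce b).Reachable (q 1) x := by
    intro x hx
    obtain ⟨c, k1, k2⟩ := sideX L hT hr le_rfl hx
    rcases k2 with k2 | k2
    · exact absurd ⟨c, k2⟩ h1
    · have : c = b := by rw [← (k2 r le_rfl le_rfl).1, ← (hb r hr le_rfl).1]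
      subst this
      exact (hb0 r hr (by omega)).trans k1
  have hbV : ∀ i, 2 ≤ i → i ≤ r + 1 → cv (q i) = b := by
    intro i k1 k2
    obtain ⟨i, rfl⟩ : ∃ i', i = i' + 1 := ⟨i - 1, by omega⟩
    exact (hb i (by omega) (by omega)).2
  -- finishing when the left end joins the component
  have fin1 : (Gc G ce b).Reachable (q 1) (q 0) →
      r + 1 ≤ Vc cv b →
      colorsUsed G ce cv + X.card + 2 * r + 1 ≤ G.edgeSet.ncard + Fintype.card V := by
    intro hq W
    have E := L.EB (ce := ce) (c := b) (X' := X) (S := Finset.range (r + 2)) le_rfl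
      (fun i hi => by rw [Finset.mem_range] at hi; omega) (q 1) hXb (by
        intro i hi
        rw [Finset.mem_range] at hi
        rcases Nat.eq_zero_or_pos i with rfl | h0
        · exact hq
        · exact hb0 i h0 (by omega))
    have C := lemCol (G := G) (ce := ce) (cv := cv) {b}
    simp only [Finset.card_range, Finset.card_singleton, Finset.sum_singleton] at E C
    omega
  obtain ⟨c, k1, k2⟩ := ends L hT
  rcases k2 with k2 | ⟨y, hy, hyc, hry⟩
  · have : c = b := by rw [← (k2 r le_rfl).1, ← (hb r hr le_rfl).1]
    subst this
    apply fin1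
    · exact (hb0 (r + 1) (by omega) le_rfl).trans k1.symm
    · have W := L.VB (cv := cv) (c := c) (X' := ∅) (S := Finset.Icc 1 (r + 1)) (by simp)
        (fun i hi => by rw [Finset.mem_Icc] at hi; omega) (by simp) (by
          intro i hi
          rw [Finset.mem_Icc] at hi
          by_cases h : i = 1
          · subst h
            exact (k2 0 (by omega)).2 hr
          · exact hbV i (by omega) hi.2)
      simp only [Nat.card_Icc, Finset.card_empty] at W
      omega
  · by_cases hcb : b = c
    · subst hcb
      apply fin1
      · exact (hb0 (r + 1) (by omega) le_rfl).trans k1.symm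
      · have W := L.VB (cv := cv) (c := b) (X' := {y}) (S := Finset.Icc 2 (r + 1)) (by simpa using hy)
          (fun i hi => by rw [Finset.mem_Icc] at hi; omega) (by simpa using hyc) (by
            intro i hi
            rw [Finset.mem_Icc] at hi
            exact hbV i (by omega) hi.2)
        simp only [Nat.card_Icc, Finset.card_singleton] at W
        omega
    · have E := L.EB (ce := ce) (c := b) (X' := X) (S := Finset.Icc 1 (r + 1)) le_rfl
        (fun i hi => by rw [Finset.mem_Icc] at hi; omega) (q 1) hXb (by
          intro i hi
          rw [Finset.mem_Icc] at hi
          exact hb0 i hi.1 hi.2)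
      have W := L.VB (cv := cv) (c := b) (X' := ∅) (S := Finset.Icc 2 (r + 1)) (by simp)
        (fun i hi => by rw [Finset.mem_Icc] at hi; omega) (by simp) (by
          intro i hi
          rw [Finset.mem_Icc] at hi
          exact hbV i (by omega) hi.2)
      have E' := L.EB (ce := ce) (c := c) (X' := {y}) (S := {0, r + 1}) (by simpa using hy)
        (fun i hi => by simp only [Finset.mem_insert, Finset.mem_singleton] at hi; omega) (q 0)
        (by simpa using hry) (by
          intro i hi
          simp only [Finset.mem_insert, Finset.mem_singleton] at hi
          rcases hi with rfl | rfl
          · exact Reachable.refl _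
          · exact k1)
      rw [Finset.card_pair (by omega)] at E'
      have W' := L.VB (cv := cv) (c := c) (X' := {y}) (S := ∅) (by simpa using hy) (by simp)
        (by simpa using hyc) (by simp)
      have C := lemCol (G := G) (ce := ce) (cv := cv) {b, c}
      rw [Finset.sum_pair hcb, Finset.card_pair hcb] at C
      simp only [Nat.card_Icc, Finset.card_singleton, Finset.card_empty] at E W E' W'
      omega

lemma caseD [Fintype V] {r : ℕ} {q : ℕ → V} {X : Finset V} (L : Lad G r q X)
    (hT : IsTMCColoring G ce cv) (hr : 1 ≤ r)
    (h1 : ∃ c, LO ce cv q r c) (h2 : ∃ c, RO ce cv q r 1 c) :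
    colorsUsed G ce cv + X.card + 2 * r + 1 ≤ G.edgeSet.ncard + Fintype.card V := by
  obtain ⟨a, ha⟩ := h1
  obtain ⟨b, hb⟩ := h2
  have ha0 := L.LOr (by omega) ha
  have hb0 := L.ROr hb
  have hX0 : ∀ x ∈ X, (Gc G ce a).Reachable (q 1) x ∨ (Gc G ce b).Reachable (q 1) x := by
    intro x hx
    obtain ⟨c, k1, k2⟩ := sideX L hT le_rfl hr hx
    rcases k2 with k2 | k2
    · have : c = a := by rw [← (k2 0 (by omega)).1, ← (ha 0 (by omega)).1]
      subst this
      exact Or.inl k1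
    · have : c = b := by rw [← (k2 r hr le_rfl).1, ← (hb r hr le_rfl).1]
      subst this
      exact Or.inr k1
  by_cases hab : a = b
  · subst hab
    have E := L.EB (ce := ce) (c := a) (X' := X) (S := Finset.range (r + 2)) le_rfl
      (fun i hi => by rw [Finset.mem_range] at hi; omega) (q 1)
      (fun x hx => (hX0 x hx).elim id id) (by
        intro i hi
        rw [Finset.mem_range] at hi
        rcases Nat.eq_zero_or_pos i with rfl | h0
        · exact (ha0 1 hr).symm
        · exact hb0 i h0 (by omega))
    have W := L.VB (cv := cv) (c := a) (X' := ∅) (S := (Finset.range (r + 2)).erase 1) (by simp)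
      (fun i hi => by rw [Finset.mem_erase, Finset.mem_range] at hi; omega) (by simp) (by
        intro i hi
        rw [Finset.mem_erase, Finset.mem_range] at hi
        rcases Nat.eq_zero_or_pos i with rfl | h0
        · exact (ha 0 hr).2
        · obtain ⟨i, rfl⟩ : ∃ i', i = i' + 1 := ⟨i - 1, by omega⟩
          exact (hb i (by omega) (by omega)).2)
    rw [Finset.card_erase_of_mem (by rw [Finset.mem_range]; omega)] at W
    have C := lemCol (G := G) (ce := ce) (cv := cv) {a}
    simp only [Finset.card_range, Finset.card_singleton, Finset.sum_singleton, Finset.card_empty] at E W C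
    omega
  · have hr1 : r = 1 := by
      by_contra h
      apply hab
      rw [← (ha 1 (by omega)).1, ← (hb 1 le_rfl hr).1]
    subst hr1
    set Xa := X.filter (fun x => (Gc G ce a).Reachable (q 1) x) with hXa
    set Xb := X.filter (fun x => ¬ (Gc G ce a).Reachable (q 1) x) with hXb
    have hcard : Xa.card + Xb.card = X.card := Finset.card_filter_add_card_filter_not _
    have hXa1 : ∀ x ∈ Xa, (Gc G ce a).Reachable (q 1) x := fun x hx => (Finset.mem_filter.1 hx).2
    have hXb1 : ∀ x ∈ Xb, (Gc G ce b).Reachable (q 1) x := fun x hx =>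
      (hX0 x (Finset.mem_filter.1 hx).1).resolve_left (Finset.mem_filter.1 hx).2
    have hsa : Xa ⊆ X := Finset.filter_subset _ _
    have hsb : Xb ⊆ X := Finset.filter_subset _ _
    have q10 : (Gc G ce a).Reachable (q 1) (q 0) := (ha0 1 le_rfl).symm
    have q12 : (Gc G ce b).Reachable (q 1) (q 2) := hb0 2 (by omega) (by omega)
    have Ea := L.EB (ce := ce) (c := a) (X' := Xa) (S := {0, 1}) hsa
        (fun i hi => by simp only [Finset.mem_insert, Finset.mem_singleton] at hi; omega) (q 1)
        hXa1 (by
          intro i hi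
          simp only [Finset.mem_insert, Finset.mem_singleton] at hi
          rcases hi with rfl | rfl
          · exact q10
          · exact Reachable.refl _)
    have Eb := L.EB (ce := ce) (c := b) (X' := Xb) (S := {1, 2}) hsb
        (fun i hi => by simp only [Finset.mem_insert, Finset.mem_singleton] at hi; omega) (q 1)
        hXb1 (by
          intro i hi
          simp only [Finset.mem_insert, Finset.mem_singleton] at hi
          rcases hi with rfl | rfl
          · exact Reachable.refl _
          · exact q12)
    have Wa := L.VB (cv := cv) (c := a) (X' := ∅) (S := {0}) (by simp) (by simp) (by simp)
      (by simpa using (ha 0 (by omega)).2)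
    have Wb := L.VB (cv := cv) (c := b) (X' := ∅) (S := {2}) (by simp) (by simp) (by simp)
      (by simpa using (hb 1 (by omega) (by omega)).2)
    have C := lemCol (G := G) (ce := ce) (cv := cv) {a, b}
    rw [Finset.sum_pair hab, Finset.card_pair hab] at C
    rw [Finset.card_pair (by omega)] at Ea Eb
    simp only [Finset.card_singleton, Finset.card_empty] at Wa Wb
    obtain ⟨c, k1, k2⟩ := ends L hT
    rcases k2 with k2 | ⟨y, hy, hyc, hry⟩
    · exfalso
      apply hab
      rw [← (ha 0 (by omega)).1, ← (hb 1 le_rfl hr).1, (k2 0 (by omega)).1, (k2 1 (by omega)).1]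
    · by_cases hca : c = a
      · subst hca
        have Ea := L.EB (ce := ce) (c := c) (X' := Xa) (S := {0, 1, 2}) hsa
          (fun i hi => by simp only [Finset.mem_insert, Finset.mem_singleton] at hi; omega) (q 1)
          hXa1 (by
            intro i hi
            simp only [Finset.mem_insert, Finset.mem_singleton] at hi
            rcases hi with rfl | rfl | rfl
            · exact q10
            · exact Reachable.refl _
            · exact q10.trans k1)
        have e3 : ({0, 1, 2} : Finset ℕ).card = 3 := by decide
        omega
      by_cases hcb : c = b
      · subst hcb
        have Eb := L.EB (ce := ce) (c := c) (X' := Xb) (S := {0, 1, 2}) hsb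
          (fun i hi => by simp only [Finset.mem_insert, Finset.mem_singleton] at hi; omega) (q 1)
          hXb1 (by
            intro i hi
            simp only [Finset.mem_insert, Finset.mem_singleton] at hi
            rcases hi with rfl | rfl | rfl
            · exact q12.trans k1.symm
            · exact Reachable.refl _
            · exact q12)
        have e3 : ({0, 1, 2} : Finset ℕ).card = 3 := by decide
        omega
      have E' := L.EB (ce := ce) (c := c) (X' := {y}) (S := {0, 2}) (by simpa using hy)
        (fun i hi => by simp only [Finset.mem_insert, Finset.mem_singleton] at hi; omega) (q 0)
        (by simpa using hry) (by
          intro i hi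
          simp only [Finset.mem_insert, Finset.mem_singleton] at hi
          rcases hi with rfl | rfl
          · exact Reachable.refl _
          · exact k1)
      rw [Finset.card_pair (by omega)] at E'
      have W' := L.VB (cv := cv) (c := c) (X' := {y}) (S := ∅) (by simpa using hy) (by simp)
        (by simpa using hyc) (by simp)
      have C := lemCol (G := G) (ce := ce) (cv := cv) {c, a, b}
      have hnm : c ∉ ({a, b} : Finset ℕ) := by
        simp only [Finset.mem_insert, Finset.mem_singleton]; tauto
      rw [Finset.sum_insert hnm, Finset.card_insert_of_notMem hnm, Finset.sum_pair hab,
        Finset.card_pair hab] at C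
      simp only [Finset.card_singleton, Finset.card_empty] at E' W'
      omega

theorem loss [Fintype V] {r : ℕ} {q : ℕ → V} {X : Finset V} (L : Lad G r q X)
    (hT : IsTMCColoring G ce cv) (hr : 1 ≤ r) (hX : X.Nonempty) :
    colorsUsed G ce cv + X.card + 2 * r + 1 ≤ G.edgeSet.ncard + Fintype.card V := by
  by_cases h1 : ∃ c, LO ce cv q r c
  · by_cases h2 : ∃ c, RO ce cv q r 1 c
    · exact caseD L hT hr h1 h2
    · refine caseB L.rev hT hr ?_ ?_
      · rintro ⟨c, hc⟩
        apply h2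
        refine ⟨c, ?_⟩
        have := LO_rev hc
        rwa [show r + 1 - r = 1 by omega] at this
      · obtain ⟨c, hc⟩ := h1
        refine ⟨c, ?_⟩
        intro l k1 k2
        have := hc (r - l) (by omega)
        have e1 : r + 1 - (l + 1) = r - l := by omega
        have e2 : r + 1 - l = r - l + 1 := by omega
        beta_reduce
        rw [e1, e2, Sym2.eq_swap]
        exact this
  · by_cases h2 : ∃ c, RO ce cv q r 1 c
    · exact caseB L hT hr h1 h2
    · exact caseA L hT hr hX h1 h2

end DJS

namespace DJS
open scoped Classical

/-- ordered edges of the extremal graph -/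
def PE (n t d a b : ℕ) : Prop := a < b ∧ (b < t ∨ (b = a + 1 ∧ t ≤ b) ∨ (b = n - 1 ∧ a < d))

/-- the extremal graph -/
def XG (n t d : ℕ) : SimpleGraph (Fin n) where
  Adj x y := PE n t d x.val y.val ∨ PE n t d y.val x.val
  symm := ⟨fun _ _ h => h.symm⟩
  loopless := ⟨fun x h => by unfold PE at h; omega⟩

lemma XG_adj {n t d : ℕ} {x y : Fin n} :
    (XG n t d).Adj x y ↔ PE n t d x.val y.val ∨ PE n t d y.val x.val := Iff.rfl

lemma XG_conn {n t d : ℕ} (ht : 2 ≤ t) (hn : t + 2 ≤ n) : (XG n t d).Connected := by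
  have h0 : ∀ (k : ℕ) (hk : k < n), (XG n t d).Reachable ⟨0, by omega⟩ ⟨k, hk⟩ := by
    intro k
    induction k with
    | zero => intro _; exact Reachable.refl _
    | succ k ih =>
      intro hk
      refine (ih (by omega)).trans (Adj.reachable ?_)
      rw [XG_adj]
      left
      change k < k + 1 ∧ (k + 1 < t ∨ (k + 1 = k + 1 ∧ t ≤ k + 1) ∨ (k + 1 = n - 1 ∧ k < d))
      omega
  have : Nonempty (Fin n) := ⟨⟨0, by omega⟩⟩
  refine ⟨?_⟩
  intro x y
  exact (h0 x.val x.isLt).symm.trans (h0 y.val y.isLt)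

lemma XG_edges {n t d : ℕ} (ht : 2 ≤ t) (hn : t + 2 ≤ n) (hd : d ≤ t - 1) :
    (XG n t d).edgeSet.ncard = t.choose 2 + (n - t) + d := by
  have : NeZero n := ⟨by omega⟩
  have hv : ∀ a, a < n → (Fin.ofNat n a).val = a := fun a ha => Nat.mod_eq_of_lt ha
  let A : Finset (ℕ × ℕ) := ((Finset.range t).sigma (fun b => Finset.range b)).image (fun p => (p.2, p.1))
  let B : Finset (ℕ × ℕ) := (Finset.Ico t n).image (fun b => (b - 1, b))
  let C : Finset (ℕ × ℕ) := (Finset.range d).image (fun a => (a, n - 1))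
  have mA : ∀ a b, (a, b) ∈ A ↔ a < b ∧ b < t := by
    intro a b
    simp only [A, Finset.mem_image, Finset.mem_sigma, Finset.mem_range, Prod.mk.injEq]
    constructor
    · rintro ⟨⟨x, y⟩, h, rfl, rfl⟩; exact ⟨h.2, h.1⟩
    · intro h; exact ⟨⟨b, a⟩, ⟨h.2, h.1⟩, rfl, rfl⟩
  have mB : ∀ a b, (a, b) ∈ B ↔ b = a + 1 ∧ t ≤ b ∧ b < n := by
    intro a b
    simp only [B, Finset.mem_image, Finset.mem_Ico, Prod.mk.injEq]
    constructor
    · rintro ⟨x, h, rfl, rfl⟩; omega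
    · intro h; exact ⟨b, by omega, by omega, rfl⟩
  have mC : ∀ a b, (a, b) ∈ C ↔ b = n - 1 ∧ a < d := by
    intro a b
    simp only [C, Finset.mem_image, Finset.mem_range, Prod.mk.injEq]
    constructor
    · rintro ⟨x, h, rfl, rfl⟩; omega
    · intro h; exact ⟨a, by omega, rfl, by omega⟩
  have cA : A.card = t.choose 2 := by
    rw [Finset.card_image_of_injective, Finset.card_sigma]
    · simp only [Finset.card_range]
      rw [Finset.sum_range_id, Nat.choose_two_right]
    · rintro ⟨x, y⟩ ⟨z, w⟩ h
      simp only [Prod.mk.injEq] at h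
      rw [h.1, h.2]
  have cB : B.card = n - t := by
    rw [Finset.card_image_of_injective, Nat.card_Ico]
    intro x y h
    simp only [Prod.mk.injEq] at h
    exact h.2
  have cC : C.card = d := by
    rw [Finset.card_image_of_injective, Finset.card_range]
    intro x y h
    simp only [Prod.mk.injEq] at h
    exact h.1
  have dAB : Disjoint A B := by
    rw [Finset.disjoint_left]
    rintro ⟨a, b⟩ h1 h2
    rw [mA] at h1; rw [mB] at h2; omega
  have dABC : Disjoint (A ∪ B) C := by
    rw [Finset.disjoint_left]
    rintro ⟨a, b⟩ h1 h2
    rw [Finset.mem_union, mA, mB] at h1; rw [mC] at h2; omega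
  have mF : ∀ a b, (a, b) ∈ (A ∪ B ∪ C) ↔ PE n t d a b ∧ b < n := by
    intro a b
    rw [Finset.mem_union, Finset.mem_union, mA, mB, mC]
    unfold PE
    omega
  have key : (XG n t d).edgeSet =
      (fun p : ℕ × ℕ => s(Fin.ofNat n p.1, Fin.ofNat n p.2)) '' ((A ∪ B ∪ C : Finset (ℕ × ℕ)) : Set (ℕ × ℕ)) := by
    ext e
    induction e using Sym2.ind with
    | _ x y =>
      rw [mem_edgeSet, XG_adj]
      simp only [Set.mem_image, Finset.mem_coe]
      constructor
      · rintro (h | h)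
        · refine ⟨(x.val, y.val), (mF _ _).2 ⟨h, y.isLt⟩, ?_⟩
          rw [Fin.ofNat_val_eq_self, Fin.ofNat_val_eq_self]
        · refine ⟨(y.val, x.val), (mF _ _).2 ⟨h, x.isLt⟩, ?_⟩
          rw [Fin.ofNat_val_eq_self, Fin.ofNat_val_eq_self, Sym2.eq_swap]
      · rintro ⟨⟨a, b⟩, hab, he⟩
        obtain ⟨h1, h2⟩ := (mF _ _).1 hab
        have h3 : a < n := h1.1.trans h2
        simp only [Sym2.eq_iff] at he
        rcases he with ⟨rfl, rfl⟩ | ⟨rfl, rfl⟩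
        · left; rw [hv a h3, hv b h2]; exact h1
        · right; rw [hv a h3, hv b h2]; exact h1
  rw [key, Set.ncard_image_of_injOn, Set.ncard_coe_finset, Finset.card_union_of_disjoint dABC,
    Finset.card_union_of_disjoint dAB, cA, cB, cC]
  rintro ⟨a, b⟩ hab ⟨a', b'⟩ hab' h
  obtain ⟨h1, h2⟩ := (mF _ _).1 (Finset.mem_coe.1 hab)
  obtain ⟨h1', h2'⟩ := (mF _ _).1 (Finset.mem_coe.1 hab')
  have h3 : a < n := h1.1.trans h2
  have h3' : a' < n := h1'.1.trans h2'
  have hlt := h1.1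
  have hlt' := h1'.1
  simp only [Sym2.eq_iff, Fin.ext_iff, hv a h3, hv b h2, hv a' h3', hv b' h2'] at h
  rw [Prod.mk.injEq]
  omega

lemma XG_lad {n t d : ℕ} (ht : 2 ≤ t) (hn : t + 2 ≤ n) (hd : d ≤ t - 1) [NeZero n] :
    Lad (XG n t d) (n - t - 1) (fun i => Fin.ofNat n (t - 1 + i))
      (Finset.univ.filter (fun x : Fin n => x.val < t - 1)) := by
  have hv : ∀ a, a < n → (Fin.ofNat n a).val = a := fun a ha => Nat.mod_eq_of_lt ha
  refine ⟨?_, ?_, ?_, ?_, ?_, ?_⟩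
  · intro i hi j hj h
    rw [Fin.ext_iff, hv _ (by omega), hv _ (by omega)] at h
    omega
  · intro i hi h
    rw [Finset.mem_filter, hv _ (by omega)] at h
    omega
  · intro i hi
    rw [XG_adj, hv _ (by omega), hv _ (by omega)]
    unfold PE
    omega
  · intro i hi y h
    rw [XG_adj, hv _ (by omega)] at h
    rw [Fin.ext_iff, Fin.ext_iff, hv _ (by omega), hv _ (by omega)]
    unfold PE at h
    omega
  · intro y h
    rw [XG_adj, hv _ (by omega)] at h
    rw [Finset.mem_filter, Fin.ext_iff, hv _ (by omega)]
    unfold PE at h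
    simp only [Finset.mem_univ, true_and]
    omega
  · intro y h
    rw [XG_adj, hv _ (by omega)] at h
    rw [Finset.mem_filter, Fin.ext_iff, hv _ (by omega)]
    unfold PE at h
    have := y.isLt
    simp only [Finset.mem_univ, true_and]
    omega

theorem partC {n t d k : ℕ} (ht : 2 ≤ t) (hn : t + 2 ≤ n) (hd : d ≤ t - 1)
    (hk : k = t.choose 2 + d + 3) : tmc (XG n t d) < k := by
  have : NeZero n := ⟨by omega⟩
  have L := XG_lad ht hn hd
  have hc : (Finset.univ.filter (fun x : Fin n => x.val < t - 1)).card = t - 1 := by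
    rw [Fin.card_filter_val_lt]; omega
  have hb : tmc (XG n t d) ≤ t.choose 2 + d + 2 := by
    unfold tmc
    apply csSup_le'
    rintro x ⟨ce, cv, hT, rfl⟩
    have h := loss L hT (by omega) (Finset.card_pos.1 (by omega))
    rw [XG_edges ht hn hd, Fintype.card_fin, hc] at h
    omega
  omega

end DJS

theorem stmt16 (n t s k : ℕ) (ht2 : 2 ≤ t) (htn : t ≤ n - 2) (hs : s ≤ t - 1)
    (hk : k = t.choose 2 + t + 2 - s) :
    (∀ (V : Type) [Fintype V] (G : SimpleGraph V), G.Connected →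
      Fintype.card V = n → n + k - t - 2 ≤ G.edgeSet.ncard → k ≤ tmc G) ∧
    (∃ G : SimpleGraph (Fin n), G.Connected ∧
      G.edgeSet.ncard = n + k - t - 3 ∧ tmc G < k) := by
  have hn : t + 2 ≤ n := by omega
  constructor
  · intro V _ G hG hV hE
    have hch : t.choose 2 = (t - 1).choose 2 + (t - 1) := by
      obtain ⟨u, rfl⟩ : ∃ u, t = u + 1 := ⟨t - 1, by omega⟩
      have h := Nat.choose_succ_succ' u 1
      rw [Nat.choose_one_right] at h
      norm_num at h ⊢
      omega
    exact DJS.partB hG hV ht2 hn (by omega) (by omega)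
  · refine ⟨DJS.XG n t (t - 1 - s), DJS.XG_conn ht2 hn, ?_, ?_⟩
    · rw [DJS.XG_edges ht2 hn (by omega)]; omega
    · exact DJS.partC ht2 hn (by omega) (by omega)
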